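/- For every integer h' ≥ 1 there exists an integer ν = ν(h') ≥ 1 with the following property. Let G be a finite connected graph with no clique of size h', and let S' ⊆ V(G) be such that |S'| ≥ ν, G ∖ S' is connected, and every vertex of S' has a neighbor in G ∖ S'. Then there exist a set S̃ ⊆ S' with |S̃| = h' and an induced subgraph H' of G ∖ S' for which one of the following holds: (a) H' is a path and every vertex of S̃ has a neighbor in H'; or (b) H' is a caterpillar, or the line graph of a caterpillar, or a subdivided star, every vertex of S̃ has a unique neighbor in H', and V(H') ∩ N(S̃) = Z(H'). -/

import Mathlib

open Set

/-- `f` enumerates an induced path on `n` vertices in `G`. -/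
def IsPathEmb {α : Type} (G : SimpleGraph α) (n : ℕ) (f : Fin n → α) : Prop :=
  Function.Injective f ∧
    ∀ i j : Fin n, G.Adj (f i) (f j) ↔ (i.val = j.val + 1 ∨ j.val = i.val + 1)

/-- `f` enumerates an induced path from `a` to `b`. -/
def IsPathFromTo {α : Type} (G : SimpleGraph α) (n : ℕ) (f : Fin n → α) (a b : α) : Prop :=
  IsPathEmb G n f ∧ ∃ h : 1 ≤ n, f ⟨0, h⟩ = a ∧ f ⟨n - 1, by omega⟩ = b

/-- The interior (internal vertices) of the path enumerated by `f`. -/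
def pathInterior {α : Type} (n : ℕ) (f : Fin n → α) : Set α :=
  {v | ∃ j : Fin n, 0 < j.val ∧ j.val < n - 1 ∧ f j = v}

/-- `k` pairwise internally vertex-disjoint induced paths from `a` to `b` in `G`. -/
def KDisjointPaths {α : Type} (G : SimpleGraph α) (k : ℕ) (a b : α) : Prop :=
  ∃ (n : Fin k → ℕ) (f : ∀ i, Fin (n i) → α),
    (∀ i, IsPathFromTo G (n i) (f i) a b) ∧
    (∀ i j, i ≠ j → Disjoint (pathInterior (n i) (f i)) (pathInterior (n j) (f j)))

/-- `f` enumerates an induced cycle on `n` vertices. -/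
def IsHoleEmb {α : Type} (G : SimpleGraph α) (n : ℕ) (f : ZMod n → α) : Prop :=
  Function.Injective f ∧ ∀ i j : ZMod n, G.Adj (f i) (f j) ↔ (i = j + 1 ∨ j = i + 1)

/-- `H` is the vertex set of a hole of `G` (an induced cycle with at least 4 vertices). -/
def IsHole {α : Type} (G : SimpleGraph α) (H : Set α) : Prop :=
  ∃ (n : ℕ) (f : ZMod n → α), 4 ≤ n ∧ IsHoleEmb G n f ∧ Set.range f = H

/-- `G` has no even hole. -/
def EvenHoleFree {α : Type} (G : SimpleGraph α) : Prop :=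
  ∀ H : Set α, IsHole G H → ¬ Even H.ncard

def Anticomplete {α : Type} (G : SimpleGraph α) (A B : Set α) : Prop :=
  ∀ a ∈ A, ∀ b ∈ B, ¬ G.Adj a b

/-- `X` is a stable (independent) set of `G`. -/
def StableSet {α : Type} (G : SimpleGraph α) (X : Set α) : Prop :=
  ∀ a ∈ X, ∀ b ∈ X, a ≠ b → ¬ G.Adj a b

/-- The open neighborhood of the set `A`. -/
def setNbhd {α : Type} (G : SimpleGraph α) (A : Set α) : Set α :=
  {v | v ∉ A ∧ ∃ a ∈ A, G.Adj v a}

/-- The set `A` induces a connected (nonempty) subgraph of `G`. -/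
def ConnSet {α : Type} (G : SimpleGraph α) (A : Set α) : Prop :=
  (G.induce A).Connected

/-- `D` is a connected component of the subgraph of `G` induced by `S`. -/
def IsCompOf {α : Type} (G : SimpleGraph α) (S D : Set α) : Prop :=
  D ⊆ S ∧ ConnSet G D ∧ ∀ D', D ⊆ D' → D' ⊆ S → ConnSet G D' → D' = D

/-- `G` contains an (induced) theta. -/
def HasTheta {α : Type} (G : SimpleGraph α) : Prop :=
  ∃ (a b : α) (n : Fin 3 → ℕ) (f : ∀ i, Fin (n i) → α),
    a ≠ b ∧ ¬ G.Adj a b ∧ (∀ i, 3 ≤ n i) ∧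
    (∀ i, IsPathFromTo G (n i) (f i) a b) ∧
    (∀ i j : Fin 3, i ≠ j → ∀ (u : Fin (n i)) (v : Fin (n j)),
      0 < u.val → u.val < n i - 1 → 0 < v.val → v.val < n j - 1 →
      f i u ≠ f j v ∧ ¬ G.Adj (f i u) (f j v))

/-- `G` contains an (induced) prism. -/
def HasPrism {α : Type} (G : SimpleGraph α) : Prop :=
  ∃ (n : Fin 3 → ℕ) (f : ∀ i, Fin (n i) → α),
    (∀ i, 2 ≤ n i) ∧ (∀ i, IsPathEmb G (n i) (f i)) ∧
    (∀ i j : Fin 3, i ≠ j → ∀ u v, f i u ≠ f j v) ∧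
    (∀ i j : Fin 3, i ≠ j → ∀ (u : Fin (n i)) (v : Fin (n j)),
      G.Adj (f i u) (f j v) ↔
        ((u.val = 0 ∧ v.val = 0) ∨ (u.val = n i - 1 ∧ v.val = n j - 1)))

/-- The neighbors of `x` in the hole `H`. -/
def holeNbrs {α : Type} (G : SimpleGraph α) (H : Set α) (x : α) : Set α :=
  {v ∈ H | G.Adj x v}

def IsWheel {α : Type} (G : SimpleGraph α) (H : Set α) (x : α) : Prop :=
  IsHole G H ∧ x ∉ H ∧ 3 ≤ (holeNbrs G H x).ncard

def IsTwinWheel {α : Type} (G : SimpleGraph α) (H : Set α) (x : α) : Prop :=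
  IsWheel G H x ∧ ∃ p q r : α, p ≠ q ∧ q ≠ r ∧ p ≠ r ∧
    holeNbrs G H x = {p, q, r} ∧ G.Adj p q ∧ G.Adj q r ∧ ¬ G.Adj p r

def IsShortPyramid {α : Type} (G : SimpleGraph α) (H : Set α) (x : α) : Prop :=
  IsWheel G H x ∧ ∃ p q r : α, p ≠ q ∧ q ≠ r ∧ p ≠ r ∧
    holeNbrs G H x = {p, q, r} ∧ G.Adj p q ∧ ¬ G.Adj q r ∧ ¬ G.Adj p r

def IsProperWheel {α : Type} (G : SimpleGraph α) (H : Set α) (x : α) : Prop :=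
  IsWheel G H x ∧ ¬ IsTwinWheel G H x ∧ ¬ IsShortPyramid G H x

/-- `x` is a hub of the induced subgraph `G[W]`. -/
def IsHubIn {α : Type} (G : SimpleGraph α) (W : Set α) (x : α) : Prop :=
  x ∈ W ∧ ∃ H : Set α, H ⊆ W ∧ IsProperWheel G H x

/-- `x` is a hub of `G`: the center of some proper wheel. -/
def IsHub {α : Type} (G : SimpleGraph α) (x : α) : Prop :=
  ∃ H : Set α, IsProperWheel G H x

/-- membership in the class `𝒞` of (C₄, theta, prism, even wheel)-free graphs. -/
def MemC {α : Type} (G : SimpleGraph α) : Prop :=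
  (∀ H : Set α, IsHole G H → H.ncard ≠ 4) ∧ ¬ HasTheta G ∧ ¬ HasPrism G ∧
    (∀ (H : Set α) (x : α), IsWheel G H x → ¬ Even (holeNbrs G H x).ncard)

/-- membership in the class `𝒞ₜ`: graphs in `𝒞` with no clique of size `t`. -/
def MemCt {α : Type} (t : ℕ) (G : SimpleGraph α) : Prop :=
  MemC G ∧ G.CliqueFree t

/-- `G` contains a generalized `k`-pyramid as an induced subgraph. -/
def ContainsGenPyramid {α : Type} (G : SimpleGraph α) (k : ℕ) : Prop :=
  ∃ (nP nQ : ℕ) (P : Fin nP → α) (Q : Fin nQ → α)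
    (m : Fin k → ℕ) (R : ∀ i, Fin (m i) → α) (xI zI : Fin k → ℕ),
    4 ≤ nP + nQ ∧ 1 ≤ nP ∧ 1 ≤ nQ ∧
    IsPathEmb G nP P ∧ IsPathEmb G nQ Q ∧
    (∀ i j, P i ≠ Q j) ∧
    (∀ (i : Fin nP) (j : Fin nQ), G.Adj (P i) (Q j) ↔
      ((i.val = 0 ∧ j.val = 0) ∨ (i.val = nP - 1 ∧ j.val = nQ - 1))) ∧
    (∀ i, 1 ≤ m i) ∧ (∀ i, IsPathEmb G (m i) (R i)) ∧
    (∀ i u j, R i u ≠ P j) ∧ (∀ i u j, R i u ≠ Q j) ∧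
    (∀ i i', i ≠ i' → ∀ u u', R i u ≠ R i' u' ∧ ¬ G.Adj (R i u) (R i' u')) ∧
    (∀ i, 0 < xI i ∧ xI i + 1 < nP - 1) ∧
    (∀ (i : Fin k) (u : Fin (m i)) (j : Fin nP), G.Adj (R i u) (P j) ↔
      (u.val = 0 ∧ (j.val = xI i ∨ j.val = xI i + 1))) ∧
    (∀ i, zI i < nQ) ∧
    (∀ (i : Fin k) (u : Fin (m i)) (j : Fin nQ), G.Adj (R i u) (Q j) ↔
      (u.val = m i - 1 ∧ j.val = zI i)) ∧
    (∀ i i' : Fin k, i < i' → xI i + 1 < xI i') ∧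
    (∀ i i' : Fin k, i ≤ i' → zI i ≤ zI i')

/-- membership in the class `𝒞ₜₜ`: graphs in `𝒞ₜ` with no induced generalized `t`-pyramid. -/
def MemCtt {α : Type} (t : ℕ) (G : SimpleGraph α) : Prop :=
  MemCt t G ∧ ¬ ContainsGenPyramid G t

/-- `(T, χ)` is a tree decomposition of `G`. -/
structure IsTD {α ι : Type} (G : SimpleGraph α) (T : SimpleGraph ι) (χ : ι → Set α) : Prop where
  finite : Finite ι
  isTree : T.IsTree
  memBag : ∀ v : α, ∃ t, v ∈ χ t
  edgeBag : ∀ ⦃u v : α⦄, G.Adj u v → ∃ t, u ∈ χ t ∧ v ∈ χ t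
  subtree : ∀ v : α, (T.induce {t | v ∈ χ t}).Connected

/-- `G` has a tree decomposition of width at most `w`. -/
def TwLE {α : Type} (G : SimpleGraph α) (w : ℕ) : Prop :=
  ∃ (ι : Type) (T : SimpleGraph ι) (χ : ι → Set α),
    IsTD G T χ ∧ ∀ t, (χ t).ncard ≤ w + 1

/-- The treewidth of `G`. -/
noncomputable def treeWidth {α : Type} (G : SimpleGraph α) : ℕ :=
  sInf {w | TwLE G w}

/-- For adjacent `t, t'` in a tree `T`, the vertex set of the component of `T - t`
containing `t'`. -/
def branchSet {ι : Type} (T : SimpleGraph ι) (t t' : ι) : Set ι :=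
  {s | ∀ w : T.Walk s t, t' ∈ w.support}

/-- The vertex set of `G_{t → t'}`: the union of the bags over the component of `T - t`
containing `t'`. -/
def sideSet {α ι : Type} (T : SimpleGraph ι) (χ : ι → Set α) (t t' : ι) : Set α :=
  ⋃ s ∈ branchSet T t t', χ s

/-- `(T, χ)` is a tight tree decomposition of `G`. -/
def TightTD {α ι : Type} (G : SimpleGraph α) (T : SimpleGraph ι) (χ : ι → Set α) : Prop :=
  IsTD G T χ ∧ ∀ ⦃t t' : ι⦄, T.Adj t t' →
    ∃ D, IsCompOf G (sideSet T χ t t' \ χ t) D ∧ setNbhd G D = χ t ∩ χ t'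

/-- `G` admits a clique cutset. -/
def HasCliqueCutset {α : Type} (G : SimpleGraph α) : Prop :=
  ∃ C : Set α, G.IsClique C ∧ ¬ (G.induce (Set.univ \ C)).Preconnected

/-- `G` is chordal: it has no hole. -/
def ChordalG {α : Type} (G : SimpleGraph α) : Prop := ∀ H : Set α, ¬ IsHole G H

/-- `G'` is a minimal chordal completion of `G`. -/
def IsMinChordalCompletion {α : Type} (G G' : SimpleGraph α) : Prop :=
  G ≤ G' ∧ ChordalG G' ∧ ∀ G'', G ≤ G'' → G'' ≤ G' → ChordalG G'' → G'' = G'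

/-- `Ω` is a potential maximal clique of `G` : a maximal clique of some minimal chordal
completion of `G`. -/
def IsPMC {α : Type} (G : SimpleGraph α) (Ω : Set α) : Prop :=
  ∃ G' : SimpleGraph α, IsMinChordalCompletion G G' ∧ G'.IsClique Ω ∧
    ∀ Ω' : Set α, G'.IsClique Ω' → Ω ⊆ Ω' → Ω' = Ω

/-- `(T, χ)` is a structured tree decomposition: every bag is a PMC of `G`. -/
def StructuredTD {α ι : Type} (G : SimpleGraph α) (T : SimpleGraph ι) (χ : ι → Set α) : Prop :=
  IsTD G T χ ∧ ∀ t, IsPMC G (χ t)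

/-- the decomposition has adhesion less than `m`. -/
def AdhLT {α ι : Type} (T : SimpleGraph ι) (χ : ι → Set α) (m : ℕ) : Prop :=
  ∀ ⦃t t' : ι⦄, T.Adj t t' → (χ t ∩ χ t').ncard < m

/-- `fatness χ i` is the number of bags of size `i`. -/
noncomputable def fatness {α ι : Type} (χ : ι → Set α) (i : ℕ) : ℕ :=
  {t : ι | (χ t).ncard = i}.ncard

/-- Lexicographic comparison of fatness vectors `(aₙ, …, a₀)` (larger sizes more
significant). -/
def FatLexLE (f g : ℕ → ℕ) : Prop :=
  (∀ i, f i = g i) ∨ ∃ j, f j < g j ∧ ∀ i, j < i → f i = g i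

/-- `(T, χ)` is an `m`-atomic tree decomposition of `G`: its adhesion is less than `m` and its
fatness is lexicographically minimum among all tree decompositions with adhesion less than `m`. -/
def IsAtomicTD {α ι : Type} (m : ℕ) (G : SimpleGraph α) (T : SimpleGraph ι)
    (χ : ι → Set α) : Prop :=
  IsTD G T χ ∧ AdhLT T χ m ∧
    ∀ (ι' : Type) (T' : SimpleGraph ι') (χ' : ι' → Set α),
      IsTD G T' χ' → AdhLT T' χ' m → FatLexLE (fatness χ) (fatness χ')

/-- Adjacency in the torso at the node `x` of the tree decomposition. -/
def torsoAdj {α ι : Type} (G : SimpleGraph α) (T : SimpleGraph ι) (χ : ι → Set α)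
    (x : ι) (u v : α) : Prop :=
  u ∈ χ x ∧ v ∈ χ x ∧ u ≠ v ∧
    (G.Adj u v ∨ ∃ y, T.Adj x y ∧ u ∈ χ y ∧ v ∈ χ y)

/-- The degree of `u` in the torso at `x`. -/
noncomputable def torsoDeg {α ι : Type} (G : SimpleGraph α) (T : SimpleGraph ι)
    (χ : ι → Set α) (x : ι) (u : α) : ℕ :=
  {v | torsoAdj G T χ x u v}.ncard

/-- `u` and `v` lie in the same component of `G[S]`. -/
def SameComp {α : Type} (G : SimpleGraph α) (S : Set α) (u v : α) : Prop :=
  ∃ (hu : u ∈ S) (hv : v ∈ S), (G.induce S).Reachable ⟨u, hu⟩ ⟨v, hv⟩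

/-- `X` is a minimal separator of `G`. -/
def IsMinimalSeparator {α : Type} (G : SimpleGraph α) (X : Set α) : Prop :=
  ∃ u v : α, u ∉ X ∧ v ∉ X ∧ ¬ SameComp G (Set.univ \ X) u v ∧
    ∀ Y : Set α, Y ⊂ X → SameComp G (Set.univ \ Y) u v
/-- The degree of `v` in `H` (as the cardinality of its neighbor set). -/
noncomputable def degreeSet {α : Type} (H : SimpleGraph α) (v : α) : ℕ :=
  (H.neighborSet v).ncard

/-- `H` is a path (as a graph). -/
def IsPathGraph {α : Type} (H : SimpleGraph α) : Prop :=
  ∃ (n : ℕ) (f : Fin n → α), Function.Bijective f ∧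
    ∀ i j, H.Adj (f i) (f j) ↔ (i.val = j.val + 1 ∨ j.val = i.val + 1)

/-- `H` is a caterpillar: a tree of maximum degree three having a path containing all
branch vertices. -/
def IsCaterpillar {α : Type} (H : SimpleGraph α) : Prop :=
  H.IsTree ∧ (∀ v, degreeSet H v ≤ 3) ∧
    ∃ (n : ℕ) (f : Fin n → α), IsPathEmb H n f ∧
      ∀ v, 2 < degreeSet H v → v ∈ Set.range f

/-- `H` is a subdivided star: a tree with exactly one branch vertex (its root), of degree
at least 3. -/
def IsSubdividedStar {α : Type} (H : SimpleGraph α) : Prop :=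
  H.IsTree ∧ ∃! r, 2 < degreeSet H r

/-- `H` is (isomorphic to) the line graph of a caterpillar. -/
def IsLineGraphOfCaterpillar {α : Type} (H : SimpleGraph α) : Prop :=
  ∃ (β : Type) (C : SimpleGraph β), IsCaterpillar C ∧
    Nonempty (SimpleGraph.Iso H C.lineGraph)

/-- `w` is a simplicial vertex of the induced subgraph `G[W]`. -/
def SimplicialIn {α : Type} (G : SimpleGraph α) (W : Set α) (w : α) : Prop :=
  w ∈ W ∧ G.IsClique {u | u ∈ W ∧ G.Adj w u}

/-- `(p, x)` is an alignment: `p` enumerates an induced path, `x` enumerates the set `X`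
in the order given by the alignment. -/
structure IsAlignment {α : Type} (G : SimpleGraph α) (n : ℕ) (p : Fin n → α)
    (k : ℕ) (x : Fin k → α) : Prop where
  hn : 1 ≤ n
  hk : 2 ≤ k
  path : IsPathEmb G n p
  injx : Function.Injective x
  disj : ∀ i j, x i ≠ p j
  cover : ∀ i, ∃ j, G.Adj (x i) (p j)
  first : ∀ j : Fin n, G.Adj (x ⟨0, by omega⟩) (p j) ↔ j.val = 0
  last : ∀ j : Fin n, G.Adj (x ⟨k - 1, by omega⟩) (p j) ↔ j.val = n - 1
  ordered : ∀ (i i' : Fin k) (j j' : Fin n),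
    i < i' → G.Adj (x i) (p j) → G.Adj (x i') (p j') → j < j'

/-- A wide alignment: every middle vertex of `X` has two non-adjacent neighbors in `P`. -/
def IsWideAlignment {α : Type} (G : SimpleGraph α) (n : ℕ) (p : Fin n → α)
    (k : ℕ) (x : Fin k → α) : Prop :=
  IsAlignment G n p k x ∧ ∀ i : Fin k, 0 < i.val → i.val < k - 1 →
    ∃ j j' : Fin n, j.val + 1 < j'.val ∧ G.Adj (x i) (p j) ∧ G.Adj (x i) (p j')

/-- A spiky alignment: every middle vertex of `X` has a unique neighbor in `P`. -/
def IsSpikyAlignment {α : Type} (G : SimpleGraph α) (n : ℕ) (p : Fin n → α)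
    (k : ℕ) (x : Fin k → α) : Prop :=
  IsAlignment G n p k x ∧ ∀ i : Fin k, 0 < i.val → i.val < k - 1 →
    ∃! j : Fin n, G.Adj (x i) (p j)

/-- A triangular alignment: every middle vertex of `X` has exactly two neighbors in `P`,
and they are adjacent. -/
def IsTriangularAlignment {α : Type} (G : SimpleGraph α) (n : ℕ) (p : Fin n → α)
    (k : ℕ) (x : Fin k → α) : Prop :=
  IsAlignment G n p k x ∧ ∀ i : Fin k, 0 < i.val → i.val < k - 1 →
    ∃ j : Fin n, j.val + 1 < n ∧
      ∀ j' : Fin n, G.Adj (x i) (p j') ↔ (j'.val = j.val ∨ j'.val = j.val + 1)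

/-- `(H, x)` is a spiky connectifier: `H` is an induced caterpillar with spine `p` and legs
`ℓ`, and `x` enumerates `X` in the order given by the connectifier (`x 0` and `x (k-1)`
attached at the ends of the spine, the others to the tips of the legs, in the order in which
the legs attach along the spine). -/
def IsSpikyConnectifier {α : Type} (G : SimpleGraph α) (H : Set α)
    (k : ℕ) (x : Fin k → α) : Prop :=
  ∃ (hk : 2 ≤ k) (n : ℕ) (_ : 2 ≤ n) (p : Fin n → α)
    (m : Fin (k - 2) → ℕ) (ℓ : ∀ i, Fin (m i) → α) (a : Fin (k - 2) → ℕ),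
    IsPathEmb G n p ∧ (∀ i, 1 ≤ m i) ∧ (∀ i, IsPathEmb G (m i) (ℓ i)) ∧
    H = Set.range p ∪ ⋃ i, Set.range (ℓ i) ∧
    Function.Injective x ∧ (∀ i, x i ∉ H) ∧
    (∀ i j j', ℓ i j ≠ p j') ∧
    (∀ i i', i ≠ i' → ∀ j j', ℓ i j ≠ ℓ i' j' ∧ ¬ G.Adj (ℓ i j) (ℓ i' j')) ∧
    (∀ i, 0 < a i ∧ a i < n - 1) ∧
    (∀ i i', i < i' → a i < a i') ∧
    (∀ (i : Fin (k - 2)) (j : Fin (m i)) (j' : Fin n),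
      G.Adj (ℓ i j) (p j') ↔ (j.val = 0 ∧ j'.val = a i)) ∧
    (∀ j : Fin n, G.Adj (x ⟨0, by omega⟩) (p j) ↔ j.val = 0) ∧
    (∀ (i : Fin (k - 2)) (j : Fin (m i)), ¬ G.Adj (x ⟨0, by omega⟩) (ℓ i j)) ∧
    (∀ j : Fin n, G.Adj (x ⟨k - 1, by omega⟩) (p j) ↔ j.val = n - 1) ∧
    (∀ (i : Fin (k - 2)) (j : Fin (m i)), ¬ G.Adj (x ⟨k - 1, by omega⟩) (ℓ i j)) ∧
    (∀ (i : Fin (k - 2)) (j : Fin n),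
      ¬ G.Adj (x ⟨i.val + 1, by have := i.isLt; omega⟩) (p j)) ∧
    (∀ (i i' : Fin (k - 2)) (j : Fin (m i')),
      G.Adj (x ⟨i.val + 1, by have := i.isLt; omega⟩) (ℓ i' j) ↔ (i' = i ∧ j.val = m i' - 1))

/-- `(H, x)` is a triangular connectifier: `H` is the line graph of a caterpillar, with
spine `p` and legs `ℓ` attached along triangles, and `x` enumerates `X` in the order given
by the connectifier. -/
def IsTriangularConnectifier {α : Type} (G : SimpleGraph α) (H : Set α)
    (k : ℕ) (x : Fin k → α) : Prop :=
  ∃ (hk : 2 ≤ k) (n : ℕ) (_ : 2 ≤ n) (p : Fin n → α)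
    (m : Fin (k - 2) → ℕ) (ℓ : ∀ i, Fin (m i) → α) (a : Fin (k - 2) → ℕ),
    IsPathEmb G n p ∧ (∀ i, 1 ≤ m i) ∧ (∀ i, IsPathEmb G (m i) (ℓ i)) ∧
    H = Set.range p ∪ ⋃ i, Set.range (ℓ i) ∧
    Function.Injective x ∧ (∀ i, x i ∉ H) ∧
    (∀ i j j', ℓ i j ≠ p j') ∧
    (∀ i i', i ≠ i' → ∀ j j', ℓ i j ≠ ℓ i' j' ∧ ¬ G.Adj (ℓ i j) (ℓ i' j')) ∧
    (∀ i, a i + 1 ≤ n - 1) ∧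
    (∀ i i', i < i' → a i < a i') ∧
    (∀ (i : Fin (k - 2)) (j : Fin (m i)) (j' : Fin n),
      G.Adj (ℓ i j) (p j') ↔ (j.val = 0 ∧ (j'.val = a i ∨ j'.val = a i + 1))) ∧
    (∀ j : Fin n, G.Adj (x ⟨0, by omega⟩) (p j) ↔ j.val = 0) ∧
    (∀ (i : Fin (k - 2)) (j : Fin (m i)), ¬ G.Adj (x ⟨0, by omega⟩) (ℓ i j)) ∧
    (∀ j : Fin n, G.Adj (x ⟨k - 1, by omega⟩) (p j) ↔ j.val = n - 1) ∧
    (∀ (i : Fin (k - 2)) (j : Fin (m i)), ¬ G.Adj (x ⟨k - 1, by omega⟩) (ℓ i j)) ∧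
    (∀ (i : Fin (k - 2)) (j : Fin n),
      ¬ G.Adj (x ⟨i.val + 1, by have := i.isLt; omega⟩) (p j)) ∧
    (∀ (i i' : Fin (k - 2)) (j : Fin (m i')),
      G.Adj (x ⟨i.val + 1, by have := i.isLt; omega⟩) (ℓ i' j) ↔ (i' = i ∧ j.val = m i' - 1))

/-- `(H, x)` is a stellar connectifier: `H` is an induced subdivided star with root `r` and
legs `ℓ`, and the vertices of `X` are attached to the tips of the legs. -/
def IsStellarConnectifier {α : Type} (G : SimpleGraph α) (H : Set α)
    (k : ℕ) (x : Fin k → α) : Prop :=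
  ∃ (_ : 3 ≤ k) (r : α) (m : Fin k → ℕ) (ℓ : ∀ i, Fin (m i) → α),
    (∀ i, 1 ≤ m i) ∧ (∀ i, IsPathEmb G (m i) (ℓ i)) ∧
    H = {r} ∪ ⋃ i, Set.range (ℓ i) ∧
    Function.Injective x ∧ (∀ i, x i ∉ H) ∧
    (∀ i j, ℓ i j ≠ r) ∧
    (∀ i i', i ≠ i' → ∀ j j', ℓ i j ≠ ℓ i' j' ∧ ¬ G.Adj (ℓ i j) (ℓ i' j')) ∧
    (∀ (i : Fin k) (j : Fin (m i)), G.Adj r (ℓ i j) ↔ j.val = 0) ∧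
    (∀ i, ¬ G.Adj (x i) r) ∧
    (∀ (i i' : Fin k) (j : Fin (m i')),
      G.Adj (x i) (ℓ i' j) ↔ (i' = i ∧ j.val = m i' - 1))

/-- `(H, X)` is a wide alignment (set version). -/
def IsWideAlignSet {α : Type} (G : SimpleGraph α) (H X : Set α) : Prop :=
  ∃ (n k : ℕ) (p : Fin n → α) (e : Fin k → α),
    H = Set.range p ∧ X = Set.range e ∧ IsWideAlignment G n p k e

/-- `(H, X)` is a spiky alignment (set version). -/
def IsSpikyAlignSet {α : Type} (G : SimpleGraph α) (H X : Set α) : Prop :=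
  ∃ (n k : ℕ) (p : Fin n → α) (e : Fin k → α),
    H = Set.range p ∧ X = Set.range e ∧ IsSpikyAlignment G n p k e

/-- `(H, X)` is a triangular alignment (set version). -/
def IsTriAlignSet {α : Type} (G : SimpleGraph α) (H X : Set α) : Prop :=
  ∃ (n k : ℕ) (p : Fin n → α) (e : Fin k → α),
    H = Set.range p ∧ X = Set.range e ∧ IsTriangularAlignment G n p k e

/-- `(H, X)` is a spiky connectifier (set version). -/
def IsSpikyConnSet {α : Type} (G : SimpleGraph α) (H X : Set α) : Prop :=
  ∃ (k : ℕ) (e : Fin k → α), X = Set.range e ∧ IsSpikyConnectifier G H k e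

/-- `(H, X)` is a triangular connectifier (set version). -/
def IsTriConnSet {α : Type} (G : SimpleGraph α) (H X : Set α) : Prop :=
  ∃ (k : ℕ) (e : Fin k → α), X = Set.range e ∧ IsTriangularConnectifier G H k e

/-- `(H, X)` is a stellar connectifier (set version). -/
def IsStellarConnSet {α : Type} (G : SimpleGraph α) (H X : Set α) : Prop :=
  ∃ (k : ℕ) (e : Fin k → α), X = Set.range e ∧ IsStellarConnectifier G H k e

/-- `(H, X)` (with order `e` on `X`) is a consistent alignment or consistent connectifier. -/
def IsConsistentWith {α : Type} (G : SimpleGraph α) (H : Set α)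
    (k : ℕ) (e : Fin k → α) : Prop :=
  (∃ (n : ℕ) (p : Fin n → α), H = Set.range p ∧
    (IsWideAlignment G n p k e ∨ IsSpikyAlignment G n p k e ∨ IsTriangularAlignment G n p k e)) ∨
  IsSpikyConnectifier G H k e ∨ IsTriangularConnectifier G H k e ∨
    IsStellarConnectifier G H k e

open SimpleGraph

section Transfer

variable {α β : Type}

theorem degreeSet_iso {H : SimpleGraph α} {K : SimpleGraph β} (e : H ≃g K) (v : α) :
    degreeSet K (e v) = degreeSet H v := by
  unfold degreeSet
  have h : K.neighborSet (e v) = e '' H.neighborSet v := by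
    ext w
    simp only [mem_neighborSet, Set.mem_image]
    constructor
    · intro hw
      refine ⟨e.symm w, ?_, by simp⟩
      rw [← e.map_adj_iff]
      simpa using hw
    · rintro ⟨x, hx, rfl⟩
      exact e.map_adj_iff.2 hx
  rw [h, Set.ncard_image_of_injective _ e.injective]

theorem degreeSet_induce_le {K : SimpleGraph β} {M t : Set β} (ht : t.Finite) {a : β} (ha : a ∈ M)
    (h : ∀ b ∈ M, K.Adj a b → b ∈ t) : degreeSet (K.induce M) ⟨a, ha⟩ ≤ t.ncard := by
  unfold degreeSet
  rw [← Set.ncard_image_of_injective _ Subtype.val_injective]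
  refine Set.ncard_le_ncard ?_ ht
  rintro _ ⟨b, hb, rfl⟩
  exact h b b.2 hb

theorem IsPathEmb.iso {H : SimpleGraph α} {K : SimpleGraph β} (e : H ≃g K) {n : ℕ}
    {f : Fin n → α} (h : IsPathEmb H n f) : IsPathEmb K n (fun i => e (f i)) :=
  ⟨e.injective.comp h.1, fun i j => by rw [e.map_adj_iff, h.2]⟩

theorem IsCaterpillar.iso {H : SimpleGraph α} {K : SimpleGraph β} (e : H ≃g K)
    (h : IsCaterpillar H) : IsCaterpillar K := by
  obtain ⟨hT, hd, n, f, hf, hb⟩ := h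
  refine ⟨e.isTree_iff.1 hT, fun v => ?_, n, fun i => e (f i), hf.iso e, fun v hv => ?_⟩
  · rw [← e.apply_symm_apply v, degreeSet_iso e]
    exact hd _
  · rw [← e.apply_symm_apply v, degreeSet_iso e] at hv
    obtain ⟨i, hi⟩ := hb _ hv
    exact ⟨i, by simp [hi]⟩

theorem IsSubdividedStar.iso {H : SimpleGraph α} {K : SimpleGraph β} (e : H ≃g K)
    (h : IsSubdividedStar H) : IsSubdividedStar K := by
  obtain ⟨hT, r, hr, hu⟩ := h
  refine ⟨e.isTree_iff.1 hT, e r, by simpa only [degreeSet_iso] using hr, fun v hv => ?_⟩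
  simp only at hv
  rw [← e.apply_symm_apply v, degreeSet_iso e] at hv
  rw [← hu _ hv, e.apply_symm_apply]

/-- An injective map on `M` that preserves and reflects adjacency induces an isomorphism
onto the graph induced on its image. -/
theorem nonempty_iso_image {K : SimpleGraph β} {G : SimpleGraph α} {M : Set β} {F : β → α}
    (hinj : Set.InjOn F M) (hadj : ∀ a ∈ M, ∀ b ∈ M, G.Adj (F a) (F b) ↔ K.Adj a b) :
    Nonempty (K.induce M ≃g G.induce (F '' M)) :=
  ⟨⟨Equiv.Set.imageOfInjOn F M hinj, fun {a b} => by
    simpa [Equiv.Set.imageOfInjOn] using hadj a a.2 b b.2⟩⟩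

end Transfer

/-- A graph whose edges join each vertex other than the root to a parent of smaller rank is
a tree. -/
theorem isTree_of_parent {β : Type} {H : SimpleGraph β} (root : β) (par : β → β) (rank : β → ℕ)
    (hrank : ∀ a, a ≠ root → rank (par a) < rank a)
    (hadj : ∀ a b, H.Adj a b ↔ (a ≠ root ∧ par a = b) ∨ (b ≠ root ∧ par b = a)) :
    H.IsTree := by
  have hreach : ∀ n a, rank a = n → H.Reachable a root := by
    intro n
    induction n using Nat.strong_induction_on with
    | _ n ih =>
      intro a ha
      by_cases h : a = root
      · rw [h]
      · exact (((hadj a (par a)).2 (Or.inl ⟨h, rfl⟩)).reachable).trans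
          (ih _ (ha ▸ hrank a h) _ rfl)
  refine ⟨(connected_iff_exists_forall_reachable H).2 ⟨root, fun w => (hreach _ w rfl).symm⟩, ?_⟩
  intro v c hc
  classical
  obtain ⟨x, hx, hmax⟩ := c.support.toFinset.exists_max_image rank ⟨v, by simp⟩
  simp only [List.mem_toFinset] at hx hmax
  have hc' := hc.rotate hx
  set c' := c.rotate x hx with hc'def
  have hmem : ∀ y ∈ c'.support, rank y ≤ rank x := by
    intro y hy
    exact hmax y ((Walk.mem_support_rotate_iff c x hx).1 hy)
  have hlow : ∀ y, H.Adj x y → rank y ≤ rank x → y = par x := by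
    intro y hxy hr
    rcases (hadj x y).1 hxy with h | h
    · exact h.2.symm
    · have := hrank y h.1
      rw [h.2] at this
      omega
  have h1 := hlow _ (c'.adj_snd hc'.not_nil) (hmem _ (c'.getVert_mem_support 1))
  have h2 := hlow _ (c'.adj_penultimate hc'.not_nil).symm (hmem _ (c'.getVert_mem_support _))
  exact hc'.snd_ne_penultimate (h1.trans h2.symm)

theorem isTree_induce_of_parent {β : Type} {K : SimpleGraph β} {M : Set β} {root : β}
    (hroot : root ∈ M) (par : β → β) (rank : β → ℕ)
    (hpar : ∀ a ∈ M, a ≠ root → par a ∈ M ∧ rank (par a) < rank a)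
    (hadj : ∀ a ∈ M, ∀ b ∈ M, K.Adj a b ↔ (a ≠ root ∧ par a = b) ∨ (b ≠ root ∧ par b = a)) :
    (K.induce M).IsTree := by
  classical
  refine isTree_of_parent ⟨root, hroot⟩
    (fun a => if h : a.1 = root then a else ⟨par a.1, (hpar _ a.2 h).1⟩) (fun a => rank a.1) ?_ ?_
  · rintro ⟨a, ha⟩ hne
    have hne' : a ≠ root := fun h => hne (Subtype.ext h)
    simpa [hne'] using (hpar a ha hne').2
  · rintro ⟨a, ha⟩ ⟨b, hb⟩
    simp only [comap_adj, Function.Embedding.subtype_apply, hadj a ha b hb, ne_eq,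
      Subtype.mk.injEq]
    by_cases hA : a = root <;> by_cases hB : b = root <;> simp [hA, hB]

/-- The parent of a vertex in the infinite comb: teeth hang off a horizontal ray. -/
def combPar (a : ℕ × ℕ) : ℕ × ℕ := if a.2 = 0 then (a.1 - 1, 0) else (a.1, a.2 - 1)

/-- The infinite comb. -/
def combGraph : SimpleGraph (ℕ × ℕ) := SimpleGraph.fromRel fun a b => combPar a = b

/-- The graph recording when the parent edges of two vertices of the comb share an end. -/
def combLineGraph : SimpleGraph (ℕ × ℕ) :=
  SimpleGraph.fromRel fun a b => combPar a = b ∨ combPar a = combPar b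

/-- The comb with spine `[lo, hi]` whose tooth at `i` has `len i` vertices. -/
def combSet (lo hi : ℕ) (len : ℕ → ℕ) : Set (ℕ × ℕ) :=
  {a | lo ≤ a.1 ∧ a.1 ≤ hi ∧ a.2 ≤ len a.1}

theorem combGraph_adj {x y x' y' : ℕ} : combGraph.Adj (x, y) (x', y') ↔
    (x = x' ∧ (y = y' + 1 ∨ y' = y + 1)) ∨ (y = 0 ∧ y' = 0 ∧ (x = x' + 1 ∨ x' = x + 1)) := by
  simp only [combGraph, SimpleGraph.fromRel_adj, combPar, ne_eq, Prod.mk.injEq]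
  split_ifs <;> simp only [Prod.mk.injEq] <;> omega

theorem combLineGraph_adj {x y x' y' : ℕ} (h : 0 < x + y) (h' : 0 < x' + y') :
    combLineGraph.Adj (x, y) (x', y') ↔
    (x = x' ∧ (y = y' + 1 ∨ y' = y + 1)) ∨ (y = 0 ∧ y' = 0 ∧ (x = x' + 1 ∨ x' = x + 1)) ∨
    (y = 0 ∧ y' = 1 ∧ x = x' + 1) ∨ (y' = 0 ∧ y = 1 ∧ x' = x + 1) := by
  simp only [combLineGraph, SimpleGraph.fromRel_adj, combPar, ne_eq, Prod.mk.injEq]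
  split_ifs <;> simp only [Prod.mk.injEq] <;> omega

theorem combPar_mem {lo hi : ℕ} {len : ℕ → ℕ} {a : ℕ × ℕ} (ha : a ∈ combSet lo hi len)
    (hne : a ≠ (lo, 0)) : combPar a ∈ combSet lo hi len := by
  obtain ⟨x, y⟩ := a
  obtain ⟨h1, h2, h3⟩ := ha
  simp only [ne_eq, Prod.mk.injEq] at hne h1 h2 h3
  unfold combPar
  split_ifs with h
  · simp only at h
    exact ⟨by simp only; omega, by simp only; omega, Nat.zero_le _⟩
  · exact ⟨h1, h2, by simp only; omega⟩

theorem rank_combPar_lt {lo hi : ℕ} {len : ℕ → ℕ} {a : ℕ × ℕ} (ha : a ∈ combSet lo hi len)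
    (hne : a ≠ (lo, 0)) : (combPar a).1 + (combPar a).2 < a.1 + a.2 := by
  obtain ⟨x, y⟩ := a
  obtain ⟨h1, h2, h3⟩ := ha
  simp only [ne_eq, Prod.mk.injEq] at hne h1 h2 h3
  unfold combPar
  split_ifs with h <;> simp only at h ⊢ <;> omega

theorem isCaterpillar_comb {lo hi : ℕ} (len : ℕ → ℕ) (hlo : lo ≤ hi) :
    IsCaterpillar (combGraph.induce (combSet lo hi len)) := by
  set M := combSet lo hi len with hM
  have hroot : (lo, 0) ∈ M := ⟨le_rfl, hlo, Nat.zero_le _⟩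
  refine ⟨?_, ?_, ?_⟩
  · refine isTree_induce_of_parent hroot combPar (fun a => a.1 + a.2) ?_ ?_
    · exact fun a ha hne => ⟨combPar_mem ha hne, rank_combPar_lt ha hne⟩
    · rintro ⟨x, y⟩ ⟨h1, h2, h3⟩ ⟨x', y'⟩ ⟨h1', h2', h3'⟩
      simp only [combGraph_adj, ne_eq, combPar, Prod.mk.injEq]
      simp only at h1 h2 h3 h1' h2' h3'
      split_ifs <;> simp only [Prod.mk.injEq] <;> omega
  · rintro ⟨⟨x, y⟩, hx⟩
    refine le_trans (degreeSet_induce_le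
      (t := ({combPar (x, y), (x, y + 1), (x + 1, 0)} : Set (ℕ × ℕ))) (Set.toFinite _) hx ?_) ?_
    · rintro ⟨x', y'⟩ hx' h
      simp only [combGraph_adj] at h
      simp only [Set.mem_insert_iff, Set.mem_singleton_iff, combPar]
      split_ifs <;> simp only [Prod.mk.injEq] <;> omega
    · refine (Set.ncard_insert_le _ _).trans (Nat.succ_le_succ ((Set.ncard_insert_le _ _).trans ?_))
      rw [Set.ncard_singleton]
  · refine ⟨hi - lo + 1, fun i => ⟨(lo + i.val, 0), by
      have := i.isLt
      refine ⟨?_, ?_, Nat.zero_le _⟩ <;> simp only <;> omega⟩, ⟨?_, ?_⟩, ?_⟩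
    · intro i j h
      have h1 : lo + i.val = lo + j.val := congrArg (fun z => z.1.1) h
      exact Fin.ext (by omega)
    · intro i j
      change combGraph.Adj (lo + i.val, 0) (lo + j.val, 0) ↔ _
      rw [combGraph_adj]
      omega
    · rintro ⟨⟨x, y⟩, hx⟩ hd
      by_cases hy : y = 0
      · subst hy
        obtain ⟨h1, h2, h3⟩ := hx
        simp only at h1 h2
        have h4 : lo + (x - lo) = x := by omega
        exact ⟨⟨x - lo, by omega⟩, Subtype.ext (Prod.ext h4 rfl)⟩
      · exfalso
        have h1 := degreeSet_induce_le (t := ({(x, y - 1), (x, y + 1)} : Set (ℕ × ℕ)))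
          (K := combGraph) (Set.toFinite _) hx (by
            rintro ⟨x', y'⟩ hx' h
            simp only [combGraph_adj] at h
            simp only [Set.mem_insert_iff, Set.mem_singleton_iff, Prod.mk.injEq]
            omega)
        have h2 := Set.ncard_insert_le (x, y - 1) ({(x, y + 1)} : Set (ℕ × ℕ))
        rw [Set.ncard_singleton] at h2
        omega

theorem nonempty_lineGraph_comb_iso (lo hi : ℕ) (len : ℕ → ℕ) :
    Nonempty (combLineGraph.induce (combSet lo hi len \ {(lo, 0)}) ≃g
      (combGraph.induce (combSet lo hi len)).lineGraph) := by
  set M := combSet lo hi len with hM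
  have hadj : ∀ z ∈ M \ {(lo, 0)}, combGraph.Adj z (combPar z) := by
    rintro z ⟨hz, hz'⟩
    have h1 := rank_combPar_lt hz hz'
    refine (SimpleGraph.fromRel_adj _ _ _).2 ⟨fun h => ?_, Or.inl rfl⟩
    rw [← h] at h1
    omega
  let φ : ↥(M \ {(lo, 0)}) → (combGraph.induce M).edgeSet := fun z =>
    ⟨s(⟨z.1, z.2.1⟩, ⟨combPar z.1, combPar_mem z.2.1 z.2.2⟩), hadj z.1 z.2⟩
  have hφ : Function.Bijective φ := by
    constructor
    · rintro ⟨z, hz⟩ ⟨w, hw⟩ h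
      have h1 := congrArg Subtype.val h
      simp only [φ, Sym2.eq_iff, Subtype.mk.injEq] at h1
      refine Subtype.ext ?_
      rcases h1 with h1 | ⟨h1, h2⟩
      · exact h1.1
      · have h3 := rank_combPar_lt hz.1 hz.2
        have h4 := rank_combPar_lt hw.1 hw.2
        rw [h2] at h3
        rw [← h1] at h4
        omega
    · rintro ⟨e, he⟩
      induction e using Sym2.ind with
      | _ a b =>
        obtain ⟨a, ha⟩ := a
        obtain ⟨b, hb⟩ := b
        have he' : combGraph.Adj a b := he
        have key : ∀ a ∈ M, ∀ b ∈ M, combGraph.Adj a b → combPar a = b → a ≠ (lo, 0) := by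
          rintro a ha ⟨x, y⟩ ⟨h1, h2, h3⟩ hne hab rfl
          simp only [combPar] at hab
          rw [combGraph_adj] at hne
          simp only [if_true, Prod.mk.injEq] at hab h1
          omega
        rcases (SimpleGraph.fromRel_adj _ _ _).1 he' with ⟨hne, h | h⟩
        · refine ⟨⟨a, ha, key a ha b hb he' h⟩, ?_⟩
          subst h
          rfl
        · refine ⟨⟨b, hb, key b hb a ha he'.symm h⟩, ?_⟩
          subst h
          exact Subtype.ext Sym2.eq_swap
  refine ⟨⟨Equiv.ofBijective φ hφ, ?_⟩⟩
  rintro ⟨z, hz⟩ ⟨w, hw⟩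
  have h3 := rank_combPar_lt hz.1 hz.2
  have h4 := rank_combPar_lt hw.1 hw.2
  simp only [Equiv.ofBijective_apply, SimpleGraph.lineGraph_adj_iff_exists, comap_adj,
    Function.Embedding.subtype_apply]
  rw [hφ.1.ne_iff]
  simp only [φ, combLineGraph, SimpleGraph.fromRel_adj, ne_eq, Subtype.mk.injEq]
  refine and_congr_right fun hne => ?_
  constructor
  · rintro ⟨⟨v, hv⟩, h1, h2⟩
    simp only [Sym2.mem_iff, Subtype.mk.injEq] at h1 h2
    rcases h1 with rfl | rfl <;> rcases h2 with h2 | h2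
    · exact absurd h2 hne
    · exact Or.inr (Or.inl h2.symm)
    · exact Or.inl (Or.inl h2)
    · exact Or.inl (Or.inr h2)
  · intro h
    rcases h with (h | h) | (h | h)
    · exact ⟨⟨w, hw.1⟩, by simp [h], by simp⟩
    · exact ⟨⟨combPar z, combPar_mem hz.1 hz.2⟩, by simp, by simp [h]⟩
    · exact ⟨⟨z, hz.1⟩, by simp, by simp [h]⟩
    · exact ⟨⟨combPar z, combPar_mem hz.1 hz.2⟩, by simp, by simp [h]⟩

section Outcomes

variable {V β : Type}

/-- The alternatives for a set of `h` vertices of `S'` attaching to an induced subgraph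
outside `S'`. -/
def ConnectifierOutcome (h : ℕ) (G : SimpleGraph V) (S' : Set V) : Prop :=
  ∃ St : Set V, St ⊆ S' ∧ St.ncard = h ∧
    ∃ W : Set V, W ⊆ Set.univ \ S' ∧
      ((IsPathGraph (G.induce W) ∧ ∀ s ∈ St, ∃ w ∈ W, G.Adj s w) ∨
       ((IsCaterpillar (G.induce W) ∨ IsLineGraphOfCaterpillar (G.induce W) ∨
          IsSubdividedStar (G.induce W)) ∧
        (∀ s ∈ St, ∃! w : V, w ∈ W ∧ G.Adj s w) ∧
        (∀ w ∈ W, ((∃ s ∈ St, G.Adj s w) ↔ SimplicialIn G W w))))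

/-- `p 0, …, p m` is an induced path of `G`. -/
def IsSeqPath (G : SimpleGraph V) (m : ℕ) (p : ℕ → V) : Prop :=
  (∀ i ≤ m, ∀ j ≤ m, p i = p j → i = j) ∧
    ∀ i ≤ m, ∀ j ≤ m, (G.Adj (p i) (p j) ↔ (i = j + 1 ∨ j = i + 1))

theorem outcome_of_path {h : ℕ} {G : SimpleGraph V} {S' : Set V} {m : ℕ} {p : ℕ → V}
    (hp : IsSeqPath G m p) (hpS : ∀ i ≤ m, p i ∉ S') {I : Finset ℕ} (hI : I.card = h)
    {s : ℕ → V} (hinj : Set.InjOn s I) (hs : ∀ i ∈ I, s i ∈ S')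
    (hadj : ∀ i ∈ I, ∃ j ≤ m, G.Adj (s i) (p j)) : ConnectifierOutcome h G S' := by
  refine ⟨s '' I, ?_, ?_, p '' {i | i ≤ m}, ?_, Or.inl ⟨?_, ?_⟩⟩
  · rintro _ ⟨i, hi, rfl⟩
    exact hs i hi
  · rw [hinj.ncard_image, Set.ncard_coe_finset, hI]
  · rintro _ ⟨i, hi, rfl⟩
    exact ⟨trivial, hpS i hi⟩
  · refine ⟨m + 1, fun i => ⟨p i, i, Nat.lt_succ_iff.1 i.2, rfl⟩, ⟨?_, ?_⟩, ?_⟩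
    · intro i j h
      have hi := i.2
      have hj := j.2
      exact Fin.ext (hp.1 i (by omega) j (by omega) (congrArg Subtype.val h))
    · rintro ⟨_, i, hi, rfl⟩
      exact ⟨⟨i, Nat.lt_succ_iff.2 hi⟩, rfl⟩
    · intro i j
      exact hp.2 i (Nat.lt_succ_iff.1 i.2) j (Nat.lt_succ_iff.1 j.2)
  · rintro _ ⟨i, hi, rfl⟩
    obtain ⟨j, hj, h⟩ := hadj i hi
    exact ⟨p j, ⟨j, hj, rfl⟩, h⟩

theorem simplicialIn_image {K : SimpleGraph β} {G : SimpleGraph V} {N : Set β} {F : β → V}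
    (hinj : Set.InjOn F N) (hadj : ∀ a ∈ N, ∀ b ∈ N, G.Adj (F a) (F b) ↔ K.Adj a b)
    {a : β} (ha : a ∈ N) : SimplicialIn G (F '' N) (F a) ↔ SimplicialIn K N a := by
  constructor
  · rintro ⟨-, h⟩
    refine ⟨ha, fun b hb c hc hbc => ?_⟩
    rw [← hadj b hb.1 c hc.1]
    exact h ⟨⟨b, hb.1, rfl⟩, (hadj a ha b hb.1).2 hb.2⟩ ⟨⟨c, hc.1, rfl⟩, (hadj a ha c hc.1).2 hc.2⟩
      (fun h => hbc (hinj hb.1 hc.1 h))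
  · rintro ⟨-, h⟩
    refine ⟨⟨a, ha, rfl⟩, ?_⟩
    rintro _ ⟨⟨b, hb, rfl⟩, hab⟩ _ ⟨⟨c, hc, rfl⟩, hac⟩ hbc
    rw [hadj b hb c hc]
    exact h ⟨hb, (hadj a ha b hb).1 hab⟩ ⟨hc, (hadj a ha c hc).1 hac⟩ (fun h => hbc (h ▸ rfl))

theorem not_simplicialIn {K : SimpleGraph β} {N : Set β} {a : β} (b c : β) (hb : b ∈ N)
    (hc : c ∈ N) (hab : K.Adj a b) (hac : K.Adj a c) (hne : b ≠ c) (hbc : ¬ K.Adj b c) :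
    ¬ SimplicialIn K N a :=
  fun h => hbc (h.2 ⟨hb, hab⟩ ⟨hc, hac⟩ hne)

theorem outcome_of_embedding {h : ℕ} {G : SimpleGraph V} {S' : Set V} {K : SimpleGraph β}
    {N : Set β} {F : β → V} (hinj : Set.InjOn F N)
    (hadj : ∀ a ∈ N, ∀ b ∈ N, G.Adj (F a) (F b) ↔ K.Adj a b) (hFS : ∀ a ∈ N, F a ∉ S')
    (hclass : IsCaterpillar (K.induce N) ∨ IsLineGraphOfCaterpillar (K.induce N) ∨
      IsSubdividedStar (K.induce N))
    {I : Finset ℕ} (hI : I.card = h) {s : ℕ → V} (hs : ∀ i ∈ I, s i ∈ S') (e : ℕ → β)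
    (he : ∀ i ∈ I, e i ∈ N) (hsinj : Set.InjOn s I)
    (hsadj : ∀ i ∈ I, ∀ a ∈ N, G.Adj (s i) (F a) ↔ a = e i)
    (hsimp : ∀ a ∈ N, SimplicialIn K N a ↔ ∃ i ∈ I, a = e i) : ConnectifierOutcome h G S' := by
  refine ⟨s '' I, ?_, ?_, F '' N, ?_, Or.inr ⟨?_, ?_, ?_⟩⟩
  · rintro _ ⟨i, hi, rfl⟩
    exact hs i hi
  · rw [hsinj.ncard_image, Set.ncard_coe_finset, hI]
  · rintro _ ⟨i, hi, rfl⟩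
    exact ⟨trivial, hFS i hi⟩
  · obtain ⟨φ⟩ := nonempty_iso_image hinj hadj
    rcases hclass with hc | ⟨γ, C, hC, ⟨ψ⟩⟩ | hc
    · exact Or.inl (hc.iso φ)
    · exact Or.inr (Or.inl ⟨γ, C, hC, ⟨φ.symm.trans ψ⟩⟩)
    · exact Or.inr (Or.inr (hc.iso φ))
  · rintro _ ⟨i, hi, rfl⟩
    refine ⟨F (e i), ⟨⟨_, he i hi, rfl⟩, (hsadj i hi _ (he i hi)).2 rfl⟩, ?_⟩
    rintro _ ⟨⟨a, ha, rfl⟩, h⟩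
    rw [(hsadj i hi a ha).1 h]
  · rintro _ ⟨a, ha, rfl⟩
    rw [simplicialIn_image hinj hadj ha, hsimp a ha]
    constructor
    · rintro ⟨_, ⟨i, hi, rfl⟩, h⟩
      exact ⟨i, hi, (hsadj i hi a ha).1 h⟩
    · rintro ⟨i, hi, h⟩
      exact ⟨s i, ⟨i, hi, rfl⟩, (hsadj i hi a ha).2 h⟩

end Outcomes

theorem mem_combSet {lo hi : ℕ} {len : ℕ → ℕ} {x y : ℕ} :
    (x, y) ∈ combSet lo hi len ↔ lo ≤ x ∧ x ≤ hi ∧ y ≤ len x := Iff.rfl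

theorem simplicialIn_comb {lo hi : ℕ} {len : ℕ → ℕ} (h : lo < hi) (hlo : 0 < len lo)
    (hhi : 0 < len hi) {a : ℕ × ℕ} (ha : a ∈ combSet lo hi len) :
    SimplicialIn combGraph (combSet lo hi len) a ↔ 0 < len a.1 ∧ a.2 = len a.1 := by
  obtain ⟨x, y⟩ := a
  rw [mem_combSet] at ha
  constructor
  · intro hs
    by_contra hcon
    simp only at hcon
    have hbc : ∃ b c : ℕ × ℕ, b ∈ combSet lo hi len ∧ c ∈ combSet lo hi len ∧
        combGraph.Adj (x, y) b ∧ combGraph.Adj (x, y) c ∧ b ≠ c ∧ ¬ combGraph.Adj b c := by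
      by_cases hy : y = 0
      · subst hy
        by_cases hx : x = lo
        · subst hx
          refine ⟨(x, 1), (x + 1, 0), ?_⟩
          simp [mem_combSet, combGraph_adj]
          omega
        · by_cases hx' : x = hi
          · subst hx'
            refine ⟨(x, 1), (x - 1, 0), ?_⟩
            simp [mem_combSet, combGraph_adj]
            omega
          · refine ⟨(x + 1, 0), (x - 1, 0), ?_⟩
            simp [mem_combSet, combGraph_adj]
            omega
      · refine ⟨(x, y + 1), (x, y - 1), ?_⟩
        simp [mem_combSet, combGraph_adj]
        omega
    obtain ⟨b, c, hb, hc, h4, h5, h6, h7⟩ := hbc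
    exact not_simplicialIn b c hb hc h4 h5 h6 h7 hs
  · rintro ⟨h4, h5⟩
    refine ⟨ha, ?_⟩
    have key : ∀ b ∈ combSet lo hi len, combGraph.Adj (x, y) b → b = (x, y - 1) := by
      rintro ⟨x', y'⟩ hb h7
      rw [mem_combSet] at hb
      rw [combGraph_adj] at h7
      simp only at h4 h5
      by_cases hx : x = x'
      · subst x'
        simp only [Prod.mk.injEq, true_and]
        omega
      · omega
    rintro b ⟨hb, hb'⟩ c ⟨hc, hc'⟩ hne
    exact absurd ((key b hb hb').trans (key c hc hc').symm) hne

theorem simplicialIn_combLine {lo hi : ℕ} {len : ℕ → ℕ} (h : lo < hi) (hlo : 0 < len lo)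
    (hhi : 0 < len hi) {a : ℕ × ℕ} (ha : a ∈ combSet lo hi len \ {(lo, 0)}) :
    SimplicialIn combLineGraph (combSet lo hi len \ {(lo, 0)}) a ↔
      0 < len a.1 ∧ a.2 = len a.1 := by
  obtain ⟨x, y⟩ := a
  simp only [Set.mem_sdiff, mem_combSet, Set.mem_singleton_iff, Prod.mk.injEq] at ha
  have hxy : 0 < x + y := by omega
  constructor
  · intro hs
    by_contra hcon
    simp only at hcon
    have hbc : ∃ b c d e : ℕ, (b, c) ∈ combSet lo hi len \ {(lo, 0)} ∧
        (d, e) ∈ combSet lo hi len \ {(lo, 0)} ∧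
        combLineGraph.Adj (x, y) (b, c) ∧ combLineGraph.Adj (x, y) (d, e) ∧ (b, c) ≠ (d, e) ∧
        ¬ combLineGraph.Adj (b, c) (d, e) := by
      have red : ∀ b c d e : ℕ, 0 < b + c → 0 < d + e →
          (lo ≤ b ∧ b ≤ hi ∧ c ≤ len b ∧ ¬ (b = lo ∧ c = 0)) →
          (lo ≤ d ∧ d ≤ hi ∧ e ≤ len d ∧ ¬ (d = lo ∧ e = 0)) →
          ((x = b ∧ (y = c + 1 ∨ c = y + 1)) ∨ (y = 0 ∧ c = 0 ∧ (x = b + 1 ∨ b = x + 1)) ∨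
            (y = 0 ∧ c = 1 ∧ x = b + 1) ∨ (c = 0 ∧ y = 1 ∧ b = x + 1)) →
          ((x = d ∧ (y = e + 1 ∨ e = y + 1)) ∨ (y = 0 ∧ e = 0 ∧ (x = d + 1 ∨ d = x + 1)) ∨
            (y = 0 ∧ e = 1 ∧ x = d + 1) ∨ (e = 0 ∧ y = 1 ∧ d = x + 1)) →
          ¬ (b = d ∧ c = e) →
          ¬ ((b = d ∧ (c = e + 1 ∨ e = c + 1)) ∨ (c = 0 ∧ e = 0 ∧ (b = d + 1 ∨ d = b + 1)) ∨
            (c = 0 ∧ e = 1 ∧ b = d + 1) ∨ (e = 0 ∧ c = 1 ∧ d = b + 1)) →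
          (b, c) ∈ combSet lo hi len \ {(lo, 0)} ∧
          (d, e) ∈ combSet lo hi len \ {(lo, 0)} ∧
          combLineGraph.Adj (x, y) (b, c) ∧ combLineGraph.Adj (x, y) (d, e) ∧ (b, c) ≠ (d, e) ∧
          ¬ combLineGraph.Adj (b, c) (d, e) := by
        intro b c d e hbc hde h1 h2 h3 h4 h5 h6
        rw [combLineGraph_adj hxy hbc, combLineGraph_adj hxy hde,
          combLineGraph_adj hbc hde]
        simp only [Set.mem_sdiff, mem_combSet, Set.mem_singleton_iff, ne_eq, Prod.mk.injEq]
        exact ⟨⟨⟨h1.1, h1.2.1, h1.2.2.1⟩, h1.2.2.2⟩, ⟨⟨h2.1, h2.2.1, h2.2.2.1⟩, h2.2.2.2⟩,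
          h3, h4, h5, h6⟩
      by_cases hy : y = 0
      · subst hy
        by_cases hx : x = lo + 1
        · by_cases hx' : x = hi
          · exact ⟨lo, 1, x, 1, by
              subst hx'
              exact red _ _ _ _ (by omega) (by omega) (by omega) (by omega) (by omega) (by omega)
                (by omega) (by omega)⟩
          · exact ⟨lo, 1, x + 1, 0, red _ _ _ _
              (by omega) (by omega) (by omega) (by omega) (by omega) (by omega) (by omega)
              (by omega)⟩
        · by_cases hx' : x = hi
          · exact ⟨x - 1, 0, x, 1, by
              subst hx'
              exact red _ _ _ _ (by omega) (by omega) (by omega) (by omega) (by omega) (by omega)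
                (by omega) (by omega)⟩
          · exact ⟨x - 1, 0, x + 1, 0, red _ _ _ _
              (by omega) (by omega) (by omega) (by omega) (by omega) (by omega) (by omega)
              (by omega)⟩
      · by_cases hy1 : y = 1 ∧ x = lo
        · obtain ⟨rfl, rfl⟩ := hy1
          exact ⟨x, 2, x + 1, 0, red _ _ _ _
              (by omega) (by omega) (by omega) (by omega) (by omega) (by omega) (by omega)
              (by omega)⟩
        · exact ⟨x, y + 1, x, y - 1, red _ _ _ _
              (by omega) (by omega) (by omega) (by omega) (by omega) (by omega) (by omega)
              (by omega)⟩
    obtain ⟨b, c, d, e, hb, hc, h4, h5, h6, h7⟩ := hbc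
    exact not_simplicialIn _ _ hb hc h4 h5 h6 h7 hs
  · rintro ⟨h4, h5⟩
    refine ⟨by simpa [mem_combSet] using ha, ?_⟩
    simp only at h4 h5
    have key : ∀ b c : ℕ, (b, c) ∈ combSet lo hi len \ {(lo, 0)} →
        combLineGraph.Adj (x, y) (b, c) →
        (b = x ∧ y = c + 1) ∨ (b = x + 1 ∧ c = 0 ∧ y = 1) := by
      intro b c hb h7
      simp only [Set.mem_sdiff, mem_combSet, Set.mem_singleton_iff, Prod.mk.injEq] at hb
      rw [combLineGraph_adj hxy (by omega)] at h7
      by_cases hx : x = b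
      · subst x
        omega
      · omega
    rintro ⟨b, c⟩ ⟨hb, hb'⟩ ⟨d, e⟩ ⟨hc, hc'⟩ hne
    have h6 := key b c hb hb'
    have h7 := key d e hc hc'
    simp only [Set.mem_sdiff, mem_combSet, Set.mem_singleton_iff, ne_eq, Prod.mk.injEq]
      at hb hc hne
    rw [combLineGraph_adj (by omega) (by omega)]
    omega

theorem outcome_of_comb {V : Type} {h : ℕ} {G : SimpleGraph V} {S' : Set V} {lo hi : ℕ}
    {len : ℕ → ℕ} {F : ℕ × ℕ → V} (hlt : lo < hi) (hlo : 0 < len lo) (hhi : 0 < len hi)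
    (hinj : Set.InjOn F (combSet lo hi len))
    (hadj : ∀ a ∈ combSet lo hi len, ∀ b ∈ combSet lo hi len,
      G.Adj (F a) (F b) ↔ combGraph.Adj a b)
    (hFS : ∀ a ∈ combSet lo hi len, F a ∉ S') {I : Finset ℕ} (hI : I.card = h)
    (hmem : ∀ i, i ∈ I ↔ lo ≤ i ∧ i ≤ hi ∧ 0 < len i) {s : ℕ → V} (hs : ∀ i ∈ I, s i ∈ S')
    (hsinj : Set.InjOn s I)
    (hsadj : ∀ i ∈ I, ∀ a ∈ combSet lo hi len, G.Adj (s i) (F a) ↔ a = (i, len i)) :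
    ConnectifierOutcome h G S' := by
  refine outcome_of_embedding hinj hadj hFS (Or.inl (isCaterpillar_comb len hlt.le)) hI hs
    (fun i => (i, len i)) (fun i hi => ?_) hsinj hsadj (fun a ha => ?_)
  · exact ⟨((hmem i).1 hi).1, ((hmem i).1 hi).2.1, le_rfl⟩
  · rw [simplicialIn_comb hlt hlo hhi ha]
    constructor
    · rintro ⟨h1, h2⟩
      exact ⟨a.1, (hmem _).2 ⟨ha.1, ha.2.1, h1⟩, Prod.ext rfl h2⟩
    · rintro ⟨i, hi, rfl⟩
      exact ⟨((hmem i).1 hi).2.2, rfl⟩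

theorem outcome_of_combLine {V : Type} {h : ℕ} {G : SimpleGraph V} {S' : Set V} {lo hi : ℕ}
    {len : ℕ → ℕ} {F : ℕ × ℕ → V} (hlt : lo < hi) (hlo : 0 < len lo) (hhi : 0 < len hi)
    (hinj : Set.InjOn F (combSet lo hi len \ {(lo, 0)}))
    (hadj : ∀ a ∈ combSet lo hi len \ {(lo, 0)}, ∀ b ∈ combSet lo hi len \ {(lo, 0)},
      G.Adj (F a) (F b) ↔ combLineGraph.Adj a b)
    (hFS : ∀ a ∈ combSet lo hi len \ {(lo, 0)}, F a ∉ S') {I : Finset ℕ} (hI : I.card = h)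
    (hmem : ∀ i, i ∈ I ↔ lo ≤ i ∧ i ≤ hi ∧ 0 < len i) {s : ℕ → V} (hs : ∀ i ∈ I, s i ∈ S')
    (hsinj : Set.InjOn s I)
    (hsadj : ∀ i ∈ I, ∀ a ∈ combSet lo hi len \ {(lo, 0)},
      G.Adj (s i) (F a) ↔ a = (i, len i)) :
    ConnectifierOutcome h G S' := by
  refine outcome_of_embedding hinj hadj hFS (Or.inr (Or.inl ⟨_, _,
    isCaterpillar_comb len hlt.le, nonempty_lineGraph_comb_iso lo hi len⟩)) hI hs
    (fun i => (i, len i)) (fun i hi => ?_) hsinj hsadj (fun a ha => ?_)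
  · refine ⟨⟨((hmem i).1 hi).1, ((hmem i).1 hi).2.1, le_rfl⟩, fun h0 => ?_⟩
    have h1 := ((hmem i).1 hi).2.2
    have h2 : len i = 0 := congrArg Prod.snd h0
    omega
  · rw [simplicialIn_combLine hlt hlo hhi ha]
    constructor
    · rintro ⟨h1, h2⟩
      exact ⟨a.1, (hmem _).2 ⟨ha.1.1, ha.1.2.1, h1⟩, Prod.ext rfl h2⟩
    · rintro ⟨i, hi, rfl⟩
      exact ⟨((hmem i).1 hi).2.2, rfl⟩

/-- The parent of a vertex in the infinite subdivided star with root `(0, 0)`. -/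
def spiderPar (a : ℕ × ℕ) : ℕ × ℕ := if a.2 ≤ 1 then (0, 0) else (a.1, a.2 - 1)

/-- The infinite subdivided star with root `(0, 0)`. -/
def spiderGraph : SimpleGraph (ℕ × ℕ) := SimpleGraph.fromRel fun a b => spiderPar a = b

/-- The subdivided star whose legs are indexed by `I`, the leg at `i` having `len i` vertices. -/
def spiderSet (I : Finset ℕ) (len : ℕ → ℕ) : Set (ℕ × ℕ) :=
  {a | a = (0, 0) ∨ a.1 ∈ I ∧ 0 < a.2 ∧ a.2 ≤ len a.1}

theorem spiderGraph_adj {x y x' y' : ℕ} (hy : 0 < y) (hy' : 0 < y') :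
    spiderGraph.Adj (x, y) (x', y') ↔ x = x' ∧ (y = y' + 1 ∨ y' = y + 1) := by
  simp only [spiderGraph, SimpleGraph.fromRel_adj, spiderPar, ne_eq, Prod.mk.injEq]
  split_ifs <;> simp only [Prod.mk.injEq] <;> omega

theorem spiderGraph_adj_root {x y : ℕ} (hy : 0 < y) : spiderGraph.Adj (0, 0) (x, y) ↔ y = 1 := by
  simp only [spiderGraph, SimpleGraph.fromRel_adj, spiderPar, ne_eq, Prod.mk.injEq]
  split_ifs <;> simp <;> omega

theorem isSubdividedStar_spider {I : Finset ℕ} {len : ℕ → ℕ} (hI : 2 < I.card)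
    (hlen : ∀ i ∈ I, 0 < len i) : IsSubdividedStar (spiderGraph.induce (spiderSet I len)) := by
  refine ⟨isTree_induce_of_parent (root := (0, 0)) (Or.inl rfl) spiderPar (fun a => a.2) ?_ ?_,
    ⟨(0, 0), Or.inl rfl⟩, ?_, ?_⟩
  · rintro ⟨x, y⟩ (h | ⟨h1, h2, h3⟩) hne
    · exact absurd h hne
    · simp only at h1 h2 h3
      unfold spiderPar
      split_ifs with h
      · exact ⟨Or.inl rfl, h2⟩
      · simp only at h
        exact ⟨Or.inr ⟨h1, by simp only; omega, by simp only; omega⟩, by simp only; omega⟩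
  · rintro ⟨x, y⟩ (h | ⟨h1, h2, h3⟩) ⟨x', y'⟩ (h' | ⟨h1', h2', h3'⟩)
    · simp [h, h']
    · rw [h, spiderGraph_adj_root h2']
      simp only at h2'
      simp only [spiderPar, ne_eq, Prod.mk.injEq]
      split_ifs <;> simp <;> omega
    · rw [h', spiderGraph.adj_comm, spiderGraph_adj_root h2]
      simp only at h2
      simp only [spiderPar, ne_eq, Prod.mk.injEq]
      split_ifs <;> simp <;> omega
    · rw [spiderGraph_adj h2 h2']
      simp only at h2 h2'
      simp only [spiderPar, ne_eq, Prod.mk.injEq]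
      split_ifs <;> simp only [Prod.mk.injEq] <;> omega
  · have hsub : (fun i => ((i, 1) : ℕ × ℕ)) '' I ⊆ Subtype.val ''
        (spiderGraph.induce (spiderSet I len)).neighborSet ⟨(0, 0), Or.inl rfl⟩ := by
      rintro _ ⟨i, hi, rfl⟩
      exact ⟨⟨(i, 1), Or.inr ⟨hi, Nat.one_pos, hlen i hi⟩⟩,
        (spiderGraph_adj_root Nat.one_pos).2 rfl, rfl⟩
    have hfin : (Subtype.val ''
        (spiderGraph.induce (spiderSet I len)).neighborSet ⟨(0, 0), Or.inl rfl⟩).Finite := by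
      refine (I.finite_toSet.image fun i => ((i, 1) : ℕ × ℕ)).subset ?_
      rintro _ ⟨⟨⟨x, y⟩, h | ⟨h1, h2, h3⟩⟩, hz, rfl⟩
      · have : spiderGraph.Adj (0, 0) (x, y) := hz
        rw [h] at this
        exact absurd rfl this.ne
      · exact ⟨x, h1, Prod.ext rfl ((spiderGraph_adj_root h2).1 hz).symm⟩
    have h1 := Set.ncard_le_ncard hsub hfin
    rw [Set.ncard_image_of_injective _ Subtype.val_injective,
      Set.ncard_image_of_injective _ (fun a b h => congrArg Prod.fst h),
      Set.ncard_coe_finset] at h1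
    exact hI.trans_le h1
  · rintro ⟨⟨x, y⟩, hx⟩ hd
    rcases id hx with h | ⟨h1, h2, h3⟩
    · exact Subtype.ext h
    · exfalso
      have h1 := degreeSet_induce_le (t := ({spiderPar (x, y), (x, y + 1)} : Set (ℕ × ℕ)))
        (K := spiderGraph) (Set.toFinite _) hx (by
          rintro ⟨x', y'⟩ hx' h
          rcases hx' with hx' | ⟨h1', h2', h3'⟩
          · rw [hx', spiderGraph.adj_comm, spiderGraph_adj_root h2] at h
            subst h
            exact Or.inl hx'
          · rw [spiderGraph_adj h2 h2'] at h
            simp only at h2'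
            simp only [Set.mem_insert_iff, Set.mem_singleton_iff, Prod.mk.injEq, spiderPar]
            split_ifs <;> simp only [Prod.mk.injEq] <;> omega)
      have h2 := Set.ncard_insert_le (spiderPar (x, y)) ({(x, y + 1)} : Set (ℕ × ℕ))
      rw [Set.ncard_singleton] at h2
      omega

theorem simplicialIn_spider {I : Finset ℕ} {len : ℕ → ℕ} (hI : 2 < I.card)
    (hlen : ∀ i ∈ I, 0 < len i) {a : ℕ × ℕ} (ha : a ∈ spiderSet I len) :
    SimplicialIn spiderGraph (spiderSet I len) a ↔ ∃ i ∈ I, a = (i, len i) := by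
  have hroot : (0, 0) ∈ spiderSet I len := Or.inl rfl
  obtain ⟨x, y⟩ := a
  constructor
  · intro hs
    rcases ha with h | ⟨h1, h2, h3⟩
    · exfalso
      obtain ⟨i, hi, j, hj, hij⟩ := Finset.one_lt_card.1 (show 1 < I.card by omega)
      rw [h] at hs
      refine not_simplicialIn (i, 1) (j, 1) (Or.inr ⟨hi, Nat.one_pos, hlen i hi⟩)
        (Or.inr ⟨hj, Nat.one_pos, hlen j hj⟩) ((spiderGraph_adj_root Nat.one_pos).2 rfl)
        ((spiderGraph_adj_root Nat.one_pos).2 rfl) (fun h => hij (congrArg Prod.fst h)) ?_ hs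
      rw [spiderGraph_adj Nat.one_pos Nat.one_pos]
      exact fun h => hij h.1
    · simp only at h1 h2 h3
      refine ⟨x, h1, Prod.ext rfl (le_antisymm h3 ?_)⟩
      by_contra hlt
      simp only at hlt
      have hup : (x, y + 1) ∈ spiderSet I len := Or.inr ⟨h1, Nat.succ_pos _, by simp only; omega⟩
      by_cases hy : y = 1
      · subst hy
        refine not_simplicialIn (x, 2) (0, 0) hup hroot
          ((spiderGraph_adj Nat.one_pos Nat.two_pos).2 (by omega))
          ((spiderGraph_adj_root Nat.one_pos).2 rfl).symm (by simp) ?_ hs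
        rw [spiderGraph.adj_comm, spiderGraph_adj_root Nat.two_pos]
        omega
      · refine not_simplicialIn (x, y + 1) (x, y - 1) hup (Or.inr ⟨h1, ?_, ?_⟩)
          ((spiderGraph_adj h2 (by omega)).2 (by omega)) ((spiderGraph_adj h2 (by omega)).2 (by omega))
          (by simp; omega) (by rw [spiderGraph_adj (by omega) (by omega)]; omega) hs
        · simp only; omega
        · simp only; omega
  · rintro ⟨i, hi, h⟩
    obtain ⟨rfl, rfl⟩ := Prod.mk.injEq _ _ _ _ ▸ h
    refine ⟨ha, ?_⟩
    have key : ∀ b ∈ spiderSet I len, spiderGraph.Adj (x, len x) b → b = spiderPar (x, len x) := by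
      rintro ⟨x', y'⟩ (hb | ⟨-, h2, h3⟩) hadj
      · rw [hb] at hadj ⊢
        have := (spiderGraph_adj_root (hlen x hi)).1 hadj.symm
        simp [spiderPar, this]
      · simp only at h2 h3
        obtain ⟨rfl, h4⟩ := (spiderGraph_adj (hlen x hi) h2).1 hadj
        rw [spiderPar, if_neg (by simp only; omega)]
        simp only [Prod.mk.injEq, true_and]
        omega
    rintro b ⟨hb, hb'⟩ c ⟨hc, hc'⟩ hne
    exact absurd ((key b hb hb').trans (key c hc hc').symm) hne

theorem outcome_of_star {V : Type} {h : ℕ} {G : SimpleGraph V} {S' : Set V}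
    {I : Finset ℕ} {len : ℕ → ℕ} {F : ℕ × ℕ → V} (hI : I.card = h) (hh : 2 < h)
    (hlen : ∀ i ∈ I, 0 < len i) (hinj : Set.InjOn F (spiderSet I len))
    (hadj : ∀ a ∈ spiderSet I len, ∀ b ∈ spiderSet I len, G.Adj (F a) (F b) ↔ spiderGraph.Adj a b)
    (hFS : ∀ a ∈ spiderSet I len, F a ∉ S') {s : ℕ → V} (hs : ∀ i ∈ I, s i ∈ S')
    (hsinj : Set.InjOn s I)
    (hsadj : ∀ i ∈ I, ∀ a ∈ spiderSet I len, G.Adj (s i) (F a) ↔ a = (i, len i)) :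
    ConnectifierOutcome h G S' :=
  outcome_of_embedding hinj hadj hFS
    (Or.inr (Or.inr (isSubdividedStar_spider (hI ▸ hh) hlen))) hI hs
    (fun i => (i, len i)) (fun i hi => Or.inr ⟨hi, hlen i hi, le_rfl⟩) hsinj hsadj
    (fun _ ha => simplicialIn_spider (hI ▸ hh) hlen ha)

section Connectivity

variable {V : Type} {G : SimpleGraph V}

/-- A set is connected when it is nonempty and no proper nonempty subset is closed under
adjacency inside it. -/
theorem connSet_iff {A : Set V} : ConnSet G A ↔ A.Nonempty ∧
    ∀ T ⊆ A, T.Nonempty → (∀ x ∈ T, ∀ y ∈ A, G.Adj x y → y ∈ T) → T = A := by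
  constructor
  · intro h
    refine ⟨Set.nonempty_coe_sort.1 h.nonempty, fun T hTA ⟨t, ht⟩ hT => hTA.antisymm ?_⟩
    intro a ha
    have hr := h.preconnected ⟨t, hTA ht⟩ ⟨a, ha⟩
    rw [reachable_iff_reflTransGen] at hr
    have key : ∀ b : A, Relation.ReflTransGen (G.induce A).Adj ⟨t, hTA ht⟩ b → b.1 ∈ T := by
      intro b hb
      induction hb with
      | refl => exact ht
      | tail _ hbc ih => exact hT _ ih _ (Subtype.property _) hbc
    exact key _ hr
  · rintro ⟨⟨a, ha⟩, h⟩
    refine (connected_iff_exists_forall_reachable _).2 ⟨⟨a, ha⟩, ?_⟩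
    have hT := h {b | ∃ hb : b ∈ A, (G.induce A).Reachable ⟨a, ha⟩ ⟨b, hb⟩}
      (fun b hb => hb.1) ⟨a, ha, Reachable.refl _⟩ (by
        rintro x ⟨hx, hax⟩ y hy hxy
        have hxy' : (G.induce A).Adj ⟨x, hx⟩ ⟨y, hy⟩ := hxy
        exact ⟨hy, hax.trans hxy'.reachable⟩)
    rintro ⟨b, hb⟩
    have hb' := hb
    rw [← hT] at hb'
    exact hb'.2

theorem ConnSet.nonempty {A : Set V} (h : ConnSet G A) : A.Nonempty := (connSet_iff.1 h).1

theorem ConnSet.eq_of_closed {A T : Set V} (h : ConnSet G A) (hTA : T ⊆ A) (hT : T.Nonempty)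
    (hcl : ∀ x ∈ T, ∀ y ∈ A, G.Adj x y → y ∈ T) : T = A :=
  (connSet_iff.1 h).2 T hTA hT hcl

theorem ConnSet.insert {A : Set V} {x y : V} (h : ConnSet G A) (hx : x ∈ A) (hxy : G.Adj x y) :
    ConnSet G (insert y A) := by
  refine connSet_iff.2 ⟨⟨y, Or.inl rfl⟩, fun T hT ⟨t, ht⟩ hcl => ?_⟩
  have hA : A ⊆ T := by
    have hne : (T ∩ A).Nonempty := by
      rcases hT ht with rfl | htA
      · exact ⟨x, hcl _ ht x (Or.inr hx) hxy.symm, hx⟩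
      · exact ⟨t, ht, htA⟩
    have := h.eq_of_closed Set.inter_subset_right hne
      (fun z hz w hw hzw => ⟨hcl z hz.1 w (Or.inr hw) hzw, hw⟩)
    exact Set.inter_eq_right.1 this
  exact hT.antisymm (Set.insert_subset (hcl x (hA hx) y (Or.inl rfl) hxy) hA)

theorem connSet_singleton (v : V) : ConnSet G {v} :=
  connSet_iff.2 ⟨Set.singleton_nonempty v, fun _ hT hne _ =>
    (Set.Nonempty.subset_singleton_iff hne).1 hT⟩

/-- `D` is a connected part of `B` attached to the rest of `B` only through `u`. -/
structure HangsAt (G : SimpleGraph V) (B : Set V) (u : V) (D : Set V) : Prop where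
  subset : D ⊆ B
  mem : u ∈ D
  conn : ConnSet G D
  closed : ∀ y ∈ D, y ≠ u → ∀ z ∈ B, G.Adj y z → z ∈ D

theorem exists_hangsAt [Finite V] {B X S : Set V} {u : V} (hB : ConnSet G B) (hX : ConnSet G X)
    (hXB : X ⊆ B) (hu : u ∈ B) (huX : u ∉ X)
    (hmin : ∀ R ⊂ B, ConnSet G R → ∃ s ∈ S, ∀ w ∈ R, ¬ G.Adj s w) :
    ∃ D, HangsAt G B u D ∧ Disjoint D X ∧ ∃ s ∈ S, ∀ w ∈ B, G.Adj s w → w ∈ D := by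
  obtain ⟨R, hXR, hR⟩ := (Set.toFinite {R : Set V | ConnSet G R ∧ R ⊆ B ∧ u ∉ R}).exists_le_maximal
    (a := X) ⟨hX, hXB, huX⟩
  obtain ⟨hRc, hRB, huR⟩ := hR.prop
  have hclosed : ∀ y ∈ B \ R, y ≠ u → ∀ z ∈ B, G.Adj y z → z ∈ B \ R := by
    rintro y ⟨hyB, hyR⟩ hyu z hz hyz
    refine ⟨hz, fun hzR => hyR ?_⟩
    refine hR.le_of_ge (y := insert y R) ⟨hRc.insert hzR hyz.symm,
      Set.insert_subset hyB hRB, ?_⟩ (Set.subset_insert y R) (Or.inl rfl)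
    rintro (h | h)
    · exact hyu h.symm
    · exact huR h
  have hno : ∀ T ⊆ B \ R, T.Nonempty → ¬ ∀ x ∈ T, ∀ y ∈ B, G.Adj x y → y ∈ T := by
    intro T hT hne hcl
    have h := hB.eq_of_closed (fun x hx => (hT hx).1) hne hcl
    obtain ⟨x, hx⟩ := hRc.nonempty
    exact (hT (h ▸ hRB hx)).2 hx
  have huD : u ∈ B \ R := ⟨hu, huR⟩
  refine ⟨B \ R, ⟨Set.sdiff_subset, huD, connSet_iff.2 ⟨⟨u, huD⟩, fun T hT hne hcl => ?_⟩,
    hclosed⟩, Set.disjoint_left.2 fun y hy hyX => hy.2 (hXR hyX), ?_⟩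
  · by_cases huT : u ∈ T
    · by_contra hTD
      have hne2 : ((B \ R) \ T).Nonempty := by
        rw [Set.nonempty_iff_ne_empty, ne_eq, Set.sdiff_eq_empty]
        exact fun h => hTD (hT.antisymm h)
      refine hno _ Set.sdiff_subset hne2 ?_
      rintro x ⟨hx, hxT⟩ y hy hxy
      have hyD := hclosed x hx (fun h => hxT (h ▸ huT)) y hy hxy
      exact ⟨hyD, fun hyT => hxT (hcl y hyT x hx hxy.symm)⟩
    · refine absurd (fun x hx y hy hxy => ?_) (hno T hT hne)
      exact hcl x hx y (hclosed x (hT hx) (fun h => huT (h ▸ hx)) y hy hxy) hxy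
  · obtain ⟨s, hs, hsR⟩ := hmin R (hRB.ssubset_of_ne fun h => huR (h ▸ hu)) hRc
    exact ⟨s, hs, fun w hw hsw => ⟨hw, fun hwR => hsR w hwR hsw⟩⟩

theorem HangsAt.eq_of_adj {B X D : Set V} {u y x : V} (h : HangsAt G B u D) (hXB : X ⊆ B)
    (hD : Disjoint D X) (hy : y ∈ D) (hx : x ∈ X) (hyx : G.Adj y x) : y = u := by
  by_contra hne
  exact Set.disjoint_left.1 hD (h.closed y hy hne x (hXB hx) hyx) hx

theorem HangsAt.disjoint {B X D D' : Set V} {u u' x x' : V} (hB : ConnSet G B) (hXB : X ⊆ B)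
    (h : HangsAt G B u D) (h' : HangsAt G B u' D') (hD : Disjoint D X) (hD' : Disjoint D' X)
    (hx : x ∈ X) (hux : G.Adj u x) (hx' : x' ∈ X) (hux' : G.Adj u' x') (hne : u ≠ u') :
    Disjoint D D' := by
  have h1 : u' ∉ D := fun hu => hne (h.eq_of_adj hXB hD hu hx' hux').symm
  have h2 : u ∉ D' := fun hu => hne (h'.eq_of_adj hXB hD' hu hx hux)
  rw [Set.disjoint_iff_inter_eq_empty]
  by_contra hne
  have := hB.eq_of_closed (T := D ∩ D') (fun z hz => h.subset hz.1)
    (Set.nonempty_iff_ne_empty.2 hne) (fun y hy z hz hyz =>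
      ⟨h.closed y hy.1 (fun e => h2 (e ▸ hy.2)) z hz hyz,
        h'.closed y hy.2 (fun e => h1 (e ▸ hy.1)) z hz hyz⟩)
  rw [← this] at hXB
  exact Set.disjoint_left.1 hD (hXB hx).1 hx

theorem HangsAt.eq_and_eq_of_adj {B D D' : Set V} {u u' y z : V}
    (h : HangsAt G B u D) (h' : HangsAt G B u' D') (hDD' : Disjoint D D') (hy : y ∈ D)
    (hz : z ∈ D') (hyz : G.Adj y z) : y = u ∧ z = u' := by
  constructor
  · by_contra hne
    exact Set.disjoint_left.1 hDD' (h.closed y hy hne z (h'.subset hz) hyz) hz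
  · by_contra hne
    exact Set.disjoint_left.1 hDD' hy (h'.closed z hz hne y (h.subset hy) hyz.symm)

theorem isSeqPath_of_dist (hG : G.Connected) {r : V} {m : ℕ} {p : ℕ → V}
    (hadj : ∀ i < m, G.Adj (p i) (p (i + 1))) (hd : ∀ i ≤ m, G.dist r (p i) = i) :
    IsSeqPath G m p := by
  refine ⟨fun i hi j hj h => by rw [← hd i hi, ← hd j hj, h], fun i hi j hj => ⟨fun h => ?_, ?_⟩⟩
  · have hne : i ≠ j := fun e => h.ne (e ▸ rfl)
    have h1 := hG.dist_triangle (u := r) (v := p i) (w := p j)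
    have h2 := hG.dist_triangle (u := r) (v := p j) (w := p i)
    rw [dist_eq_one_iff_adj.2 h, hd i hi, hd j hj] at h1
    rw [dist_eq_one_iff_adj.2 h.symm, hd i hi, hd j hj] at h2
    omega
  · rintro (rfl | rfl)
    · exact (hadj j (by omega)).symm
    · exact hadj i (by omega)

/-- A shortest path from `u` inside `D` to the vertices satisfying `P`. -/
theorem exists_isSeqPath {D : Set V} (hD : ConnSet G D) {u : V} (hu : u ∈ D) {P : V → Prop}
    (hP : ∃ w ∈ D, P w) : ∃ (l : ℕ) (q : ℕ → V), IsSeqPath G l q ∧ q 0 = u ∧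
      (∀ j ≤ l, q j ∈ D) ∧ ∀ j ≤ l, (P (q j) ↔ j = l) := by
  classical
  have hex : ∃ l, ∃ w : D, P w ∧ (G.induce D).dist ⟨u, hu⟩ w = l := by
    obtain ⟨w, hw, hPw⟩ := hP
    exact ⟨_, ⟨w, hw⟩, hPw, rfl⟩
  obtain ⟨w, hPw, hw⟩ := Nat.find_spec hex
  have hmin : ∀ z : D, P z → Nat.find hex ≤ (G.induce D).dist ⟨u, hu⟩ z :=
    fun z hz => Nat.find_min' hex ⟨z, hz, rfl⟩
  set l := Nat.find hex
  obtain ⟨c, hc⟩ := hD.exists_walk_length_eq_dist ⟨u, hu⟩ w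
  have hd : ∀ i ≤ l, (G.induce D).dist ⟨u, hu⟩ (c.getVert i) = i := by
    intro i hi
    have h1 := dist_le (c.take i)
    have h2 := dist_le (c.drop i)
    have h3 := hD.dist_triangle (u := ⟨u, hu⟩) (v := c.getVert i) (w := w)
    rw [Walk.take_length] at h1
    rw [Walk.drop_length] at h2
    omega
  have hseq := isSeqPath_of_dist hD (p := c.getVert)
    (fun i hi => c.adj_getVert_succ (by omega)) hd
  refine ⟨l, fun i => c.getVert i, ⟨fun i hi j hj h => hseq.1 i hi j hj (Subtype.ext h),
    fun i hi j hj => hseq.2 i hi j hj⟩, by simp, fun j _ => (c.getVert j).2, fun j hj => ?_⟩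
  constructor
  · intro h
    have := hmin _ h
    rw [hd j hj] at this
    omega
  · rintro rfl
    change P (c.getVert l).1
    rwa [show l = c.length by omega, c.getVert_length]

end Connectivity

/-- Ramsey's theorem for graphs. -/
theorem exists_ramsey (a b : ℕ) : ∃ n : ℕ, ∀ (V : Type) (G : SimpleGraph V) (t : Finset V),
    n ≤ t.card → (∃ c ⊆ t, c.card = a ∧ G.IsClique (c : Set V)) ∨
      ∃ c ⊆ t, c.card = b ∧ StableSet G (c : Set V) := by
  classical
  obtain ⟨k, hk⟩ : ∃ k, k = a + b := ⟨_, rfl⟩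
  induction k generalizing a b with
  | zero =>
    exact ⟨0, fun V G t _ => Or.inl ⟨∅, by simp, by simp; omega, by simp⟩⟩
  | succ k ih =>
    rcases a with _ | a
    · exact ⟨0, fun V G t _ => Or.inl ⟨∅, by simp, by simp, by simp⟩⟩
    rcases b with _ | b
    · exact ⟨0, fun V G t _ => Or.inr ⟨∅, by simp, by simp, by simp [StableSet]⟩⟩
    obtain ⟨n1, h1⟩ := ih a (b + 1) (by omega)
    obtain ⟨n2, h2⟩ := ih (a + 1) b (by omega)
    refine ⟨n1 + n2 + 1, fun V G t ht => ?_⟩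
    obtain ⟨v, hv⟩ := Finset.card_pos.1 (show 0 < t.card by omega)
    have hcard := Finset.card_filter_add_card_filter_not (s := t.erase v) (fun w => G.Adj v w)
    rw [Finset.card_erase_of_mem hv] at hcard
    have hsub : ∀ {p : V → Prop} [DecidablePred p] {c : Finset V}, c ⊆ (t.erase v).filter p →
        c ⊆ t ∧ v ∉ c ∧ ∀ w ∈ c, p w := by
      intro p _ c hc
      refine ⟨fun w hw => Finset.mem_of_mem_erase (Finset.mem_filter.1 (hc hw)).1, fun hvc =>
        Finset.notMem_erase v t (Finset.mem_filter.1 (hc hvc)).1,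
        fun w hw => (Finset.mem_filter.1 (hc hw)).2⟩
    by_cases hn : n1 ≤ ((t.erase v).filter fun w => G.Adj v w).card
    · rcases h1 V G _ hn with ⟨c, hct, hc, hcl⟩ | ⟨c, hct, hc, hcl⟩
      · obtain ⟨h3, h4, h5⟩ := hsub hct
        refine Or.inl ⟨insert v c, Finset.insert_subset hv h3, by
          rw [Finset.card_insert_of_notMem h4, hc], ?_⟩
        rw [Finset.coe_insert]
        exact hcl.insert fun w hw _ => h5 w hw
      · exact Or.inr ⟨c, (hsub hct).1, hc, hcl⟩
    · rcases h2 V G ((t.erase v).filter fun w => ¬ G.Adj v w) (by omega) with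
        ⟨c, hct, hc, hcl⟩ | ⟨c, hct, hc, hcl⟩
      · exact Or.inl ⟨c, (hsub hct).1, hc, hcl⟩
      · obtain ⟨h3, h4, h5⟩ := hsub hct
        refine Or.inr ⟨insert v c, Finset.insert_subset hv h3, by
          rw [Finset.card_insert_of_notMem h4, hc], ?_⟩
        rw [Finset.coe_insert]
        rintro x (rfl | hx) y (rfl | hy) hxy
        · exact absurd rfl hxy
        · exact h5 y hy
        · exact fun h => h5 x hx h.symm
        · exact hcl x hx y hy hxy

/-- A lower bound on the number of weights that guarantees a path with `k` useful vertices. -/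
def heavyBound (Δ h : ℕ) : ℕ → ℕ
  | 0 => 0
  | k + 1 => Δ * heavyBound Δ h k + h

section Heavy

variable {W ι : Type} {H : SimpleGraph W} {r : W}

/-- `u` is a neighbor of `v` one step further away from `r`. -/
def IsChild (H : SimpleGraph W) (r v u : W) : Prop := H.Adj v u ∧ H.dist r u = H.dist r v + 1

/-- Some shortest path from `r` to `x` passes through `v`. -/
def IsDesc (H : SimpleGraph W) (r v x : W) : Prop := H.dist r x = H.dist r v + H.dist v x

theorem IsDesc.exists_child (hH : H.Connected) {v x : W} (h : IsDesc H r v x) (hne : x ≠ v) :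
    ∃ u, IsChild H r v u ∧ IsDesc H r u x := by
  obtain ⟨c, hc⟩ := hH.exists_walk_length_eq_dist v x
  cases c with
  | nil => exact absurd rfl hne
  | @cons _ u _ hvu c =>
    rw [Walk.length_cons] at hc
    have h1 := dist_le c
    have h2 := hH.dist_triangle (u := r) (v := v) (w := u)
    have h3 := hH.dist_triangle (u := r) (v := u) (w := x)
    rw [dist_eq_one_iff_adj.2 hvu] at h2
    unfold IsDesc at h
    exact ⟨u, ⟨hvu, by omega⟩, show _ = _ by omega⟩

/-- Among sufficiently many weighted vertices, some path running away from `r` has `k`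
vertices that carry a weight or have a second child. -/
theorem exists_useful_path [Fintype W] (hH : H.Connected) {Δ h : ℕ} (y : ι → W)
    {A : Finset ι} (hdeg : ∀ v, ∀ t : Finset W, (∀ u ∈ t, H.Adj v u) → t.card ≤ Δ)
    (hfib : ∀ v, ∀ t ⊆ A, (∀ s ∈ t, y s = v) → t.card < h) (k : ℕ)
    (hA : heavyBound Δ h k ≤ A.card) :
    ∃ (m : ℕ) (p : ℕ → W), p 0 = r ∧ (∀ i < m, IsChild H r (p i) (p (i + 1))) ∧
      ∃ U : Finset ℕ, k ≤ U.card ∧ ∀ i ∈ U, i ≤ m ∧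
        ((∃ s ∈ A, y s = p i) ∨ (i < m ∧ ∃ u, IsChild H r (p i) u ∧ u ≠ p (i + 1))) := by
  classical
  have hbdd : ∃ N, ∀ v, H.dist r v ≤ N :=
    ⟨Finset.univ.sup fun v => H.dist r v, fun v =>
      Finset.le_sup (f := fun v => H.dist r v) (Finset.mem_univ v)⟩
  obtain ⟨N, hN⟩ := hbdd
  suffices key : ∀ n, ∀ v, N - H.dist r v = n → ∀ k, ∀ t ⊆ A, (∀ s ∈ t, IsDesc H r v (y s)) →
      heavyBound Δ h k ≤ t.card →
      ∃ (m : ℕ) (p : ℕ → W), p 0 = v ∧ (∀ i < m, IsChild H r (p i) (p (i + 1))) ∧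
      ∃ U : Finset ℕ, k ≤ U.card ∧ ∀ i ∈ U, i ≤ m ∧
        ((∃ s ∈ A, y s = p i) ∨ (i < m ∧ ∃ u, IsChild H r (p i) u ∧ u ≠ p (i + 1))) from
    key _ r rfl k A subset_rfl (fun s _ => by simp [IsDesc]) hA
  intro n
  induction n using Nat.strong_induction_on with
  | _ n ih =>
  intro v hv k t htA hdesc ht
  rcases k with _ | k
  · exact ⟨0, fun _ => v, rfl, by simp, ∅, by simp, by simp⟩
  have hsplit := Finset.card_filter_add_card_filter_not (s := t) (fun s => y s = v)
  have hfew := hfib v (t.filter fun s => y s = v) ((Finset.filter_subset _ _).trans htA)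
    (fun s hs => (Finset.mem_filter.1 hs).2)
  set t' := t.filter fun s => ¬ y s = v with ht'
  have hch : ∀ s ∈ t', ∃ u, IsChild H r v u ∧ IsDesc H r u (y s) := fun s hs =>
    (hdesc s (Finset.mem_filter.1 hs).1).exists_child hH (Finset.mem_filter.1 hs).2
  have : Nonempty W := ⟨v⟩
  choose! c hc hcd using hch
  simp only [heavyBound] at ht
  obtain ⟨s₀, hs₀⟩ := Finset.card_pos.1 (show 0 < t'.card by omega)
  have hlt : ∀ u, IsChild H r v u → N - H.dist r u < n := by
    intro u hu
    have := hN u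
    have := hu.2
    omega
  by_cases huse : (∃ s ∈ t, y s = v) ∨ ∃ u u', IsChild H r v u ∧ IsChild H r v u' ∧ u ≠ u'
  · have hcardc : (t'.image c).card ≤ Δ := by
      refine hdeg v _ fun u hu => ?_
      obtain ⟨s, hs, rfl⟩ := Finset.mem_image.1 hu
      exact (hc s hs).1
    obtain ⟨u, hu, hheavy⟩ := Finset.exists_le_card_fiber_of_mul_le_card_of_maps_to
      (n := heavyBound Δ h k) (f := c) (s := t') (t := t'.image c)
      (fun s hs => Finset.mem_image_of_mem c hs) ⟨_, Finset.mem_image_of_mem c hs₀⟩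
      ((Nat.mul_le_mul_right _ hcardc).trans (by omega))
    obtain ⟨s₁, hs₁, rfl⟩ := Finset.mem_image.1 hu
    obtain ⟨m, p, hp0, hp, U, hU, hUp⟩ := ih _ (hlt _ (hc s₁ hs₁)) (c s₁) rfl k
      (t'.filter fun s => c s = c s₁)
      (((Finset.filter_subset _ _).trans (Finset.filter_subset _ _)).trans htA)
      (fun s hs => (Finset.mem_filter.1 hs).2 ▸ hcd s (Finset.mem_filter.1 hs).1) hheavy
    refine ⟨m + 1, fun i => if i = 0 then v else p (i - 1), rfl, ?_,
      insert 0 (U.map ⟨Nat.succ, Nat.succ_injective⟩), ?_, ?_⟩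
    · rintro (_ | i) hi
      · simpa [hp0] using hc s₁ hs₁
      · simpa using hp i (by omega)
    · rw [Finset.card_insert_of_notMem (by simp), Finset.card_map]
      omega
    · intro i hi
      rcases Finset.mem_insert.1 hi with rfl | hi
      · refine ⟨Nat.zero_le _, ?_⟩
        rcases huse with ⟨s, hs, hsv⟩ | ⟨u, u', hu, hu', hne⟩
        · exact Or.inl ⟨s, htA hs, hsv⟩
        · refine Or.inr ⟨Nat.succ_pos _, ?_⟩
          by_cases h : u = p 0
          · exact ⟨u', hu', by simpa [← h] using hne.symm⟩
          · exact ⟨u, hu, by simpa using h⟩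
      · obtain ⟨j, hj, rfl⟩ := Finset.mem_map.1 hi
        obtain ⟨h1, h2⟩ := hUp j hj
        refine ⟨Nat.succ_le_succ h1, ?_⟩
        rcases h2 with ⟨s, hs, hsj⟩ | ⟨h2, u, hu, hne⟩
        · exact Or.inl ⟨s, hs, by simpa using hsj⟩
        · exact Or.inr ⟨Nat.succ_lt_succ h2, u, by simpa using hu, by simpa using hne⟩
  · push Not at huse
    have htt : ∀ s ∈ t, s ∈ t' := fun s hs => Finset.mem_filter.2 ⟨hs, huse.1 s hs⟩
    obtain ⟨m, p, hp0, hp, U, hU, hUp⟩ := ih _ (hlt _ (hc s₀ hs₀)) (c s₀) rfl (k + 1) t htA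
      (fun s hs => huse.2 _ _ (hc s (htt s hs)) (hc s₀ hs₀) ▸ hcd s (htt s hs)) ht
    refine ⟨m + 1, fun i => if i = 0 then v else p (i - 1), rfl, ?_,
      U.map ⟨Nat.succ, Nat.succ_injective⟩, ?_, ?_⟩
    · rintro (_ | i) hi
      · simpa [hp0] using hc s₀ hs₀
      · simpa using hp i (by omega)
    · rwa [Finset.card_map]
    · intro i hi
      obtain ⟨j, hj, rfl⟩ := Finset.mem_map.1 hi
      obtain ⟨h1, h2⟩ := hUp j hj
      refine ⟨Nat.succ_le_succ h1, ?_⟩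
      rcases h2 with ⟨s, hs, hsj⟩ | ⟨h2, u, hu, hne⟩
      · exact Or.inl ⟨s, hs, by simpa using hsj⟩
      · exact Or.inr ⟨Nat.succ_lt_succ h2, u, by simpa using hu, by simpa using hne⟩

end Heavy

section Combs

variable {V : Type} {G : SimpleGraph V} {S' : Set V} {h m : ℕ} {p : ℕ → V} {I : Finset ℕ}
  {len : ℕ → ℕ} {t : ℕ → ℕ → V} {s : ℕ → V}

/-- A family of disjoint induced paths `t x 1, …, t x (len x)`, for `x ∈ I`, pairwise
anticomplete and disjoint from the path `p 0, …, p m`, such that `s x` attaches exactly to the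
last vertex of the path with index `x`. -/
structure IsTeeth (G : SimpleGraph V) (S' : Set V) (m : ℕ) (p : ℕ → V) (I : Finset ℕ)
    (len : ℕ → ℕ) (t : ℕ → ℕ → V) (s : ℕ → V) : Prop where
  path : IsSeqPath G m p
  path_notMem : ∀ x ≤ m, p x ∉ S'
  le : ∀ x ∈ I, x ≤ m
  len_pos : ∀ x, 0 < len x ↔ x ∈ I
  notMem : ∀ x ∈ I, ∀ y, 0 < y → y ≤ len x → t x y ∉ S'
  ne : ∀ x ∈ I, ∀ y, 0 < y → y ≤ len x → ∀ z ≤ m, t x y ≠ p z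
  inj : ∀ x ∈ I, ∀ y, 0 < y → y ≤ len x → ∀ x' ∈ I, ∀ y', 0 < y' → y' ≤ len x' →
    t x y = t x' y' → x = x' ∧ y = y'
  adj : ∀ x ∈ I, ∀ y, 0 < y → y ≤ len x → ∀ x' ∈ I, ∀ y', 0 < y' → y' ≤ len x' →
    (G.Adj (t x y) (t x' y') ↔ x = x' ∧ (y = y' + 1 ∨ y' = y + 1))
  attach_mem : ∀ x ∈ I, s x ∈ S'
  attach_inj : Set.InjOn s I
  attach_path : ∀ x ∈ I, ∀ z ≤ m, ¬ G.Adj (s x) (p z)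
  attach : ∀ x ∈ I, ∀ x' ∈ I, ∀ y, 0 < y → y ≤ len x' →
    (G.Adj (s x) (t x' y) ↔ x' = x ∧ y = len x)

/-- The map from the comb to `V` given by a path and teeth. -/
def toothMap (p : ℕ → V) (t : ℕ → ℕ → V) (a : ℕ × ℕ) : V := if a.2 = 0 then p a.1 else t a.1 a.2

@[simp] theorem toothMap_zero (x : ℕ) : toothMap p t (x, 0) = p x := rfl

theorem toothMap_pos (x : ℕ) {y : ℕ} (hy : 0 < y) : toothMap p t (x, y) = t x y :=
  if_neg hy.ne'

theorem IsTeeth.mem_of_pos (hT : IsTeeth G S' m p I len t s) {x y : ℕ} (hy : 0 < y)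
    (hyl : y ≤ len x) : x ∈ I :=
  (hT.len_pos x).1 (hy.trans_le hyl)

theorem IsTeeth.injOn (hT : IsTeeth G S' m p I len t s) {lo hi : ℕ} (hhi : hi ≤ m) :
    Set.InjOn (toothMap p t) (combSet lo hi len) := by
  rintro ⟨x, y⟩ ⟨-, hx, hy⟩ ⟨x', y'⟩ ⟨-, hx', hy'⟩ heq
  simp only at hx hy hx' hy'
  rcases Nat.eq_zero_or_pos y with rfl | hpos <;> rcases Nat.eq_zero_or_pos y' with rfl | hpos'
  · rw [hT.path.1 x (hx.trans hhi) x' (hx'.trans hhi) heq]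
  · rw [toothMap_zero, toothMap_pos _ hpos'] at heq
    exact absurd heq.symm (hT.ne _ (hT.mem_of_pos hpos' hy') _ hpos' hy' _ (hx.trans hhi))
  · rw [toothMap_zero, toothMap_pos _ hpos] at heq
    exact absurd heq (hT.ne _ (hT.mem_of_pos hpos hy) _ hpos hy _ (hx'.trans hhi))
  · rw [toothMap_pos _ hpos, toothMap_pos _ hpos'] at heq
    obtain ⟨h1, h2⟩ := hT.inj _ (hT.mem_of_pos hpos hy) _ hpos hy _ (hT.mem_of_pos hpos' hy') _
      hpos' hy' heq
    rw [h1, h2]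

theorem IsTeeth.toothMap_notMem (hT : IsTeeth G S' m p I len t s) {lo hi : ℕ} (hhi : hi ≤ m)
    {a : ℕ × ℕ} (ha : a ∈ combSet lo hi len) : toothMap p t a ∉ S' := by
  obtain ⟨x, y⟩ := a
  obtain ⟨-, hx, hy⟩ := ha
  rcases Nat.eq_zero_or_pos y with rfl | hpos
  · exact hT.path_notMem _ (hx.trans hhi)
  · rw [toothMap_pos _ hpos]
    exact hT.notMem _ (hT.mem_of_pos hpos hy) _ hpos hy

theorem IsTeeth.attach_iff (hT : IsTeeth G S' m p I len t s) {lo hi : ℕ} (hhi : hi ≤ m)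
    {i : ℕ} (hi' : i ∈ I) {a : ℕ × ℕ} (ha : a ∈ combSet lo hi len) :
    G.Adj (s i) (toothMap p t a) ↔ a = (i, len i) := by
  obtain ⟨x, y⟩ := a
  obtain ⟨-, hx, hy⟩ := ha
  have hl := (hT.len_pos i).2 hi'
  rw [Prod.mk.injEq]
  rcases Nat.eq_zero_or_pos y with rfl | hpos
  · refine iff_of_false (hT.attach_path _ hi' _ (hx.trans hhi)) (fun h => ?_)
    omega
  · rw [toothMap_pos _ hpos]
    exact hT.attach _ hi' _ (hT.mem_of_pos hpos hy) _ hpos hy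

theorem exists_lo_hi (hI : 1 < I.card) : ∃ lo ∈ I, ∃ hi ∈ I, lo < hi ∧ ∀ i ∈ I, lo ≤ i ∧ i ≤ hi :=
  have hne : I.Nonempty := Finset.card_pos.1 (zero_lt_one.trans hI)
  ⟨I.min' hne, I.min'_mem hne, I.max' hne, I.max'_mem hne, I.min'_lt_max'_of_card hI,
    fun i hi => ⟨I.min'_le i hi, I.le_max' i hi⟩⟩

theorem IsTeeth.outcome_of_spiky (hT : IsTeeth G S' m p I len t s) (hI : I.card = h) (hh : 1 < h)
    (hroot : ∀ x ∈ I, ∀ y, 0 < y → y ≤ len x → ∀ z ≤ m, (G.Adj (p z) (t x y) ↔ z = x ∧ y = 1)) :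
    ConnectifierOutcome h G S' := by
  obtain ⟨lo, hlo, hi, hhi, hlt, hb⟩ := exists_lo_hi (hI ▸ hh)
  have him := hT.le hi hhi
  refine outcome_of_comb hlt ((hT.len_pos _).2 hlo) ((hT.len_pos _).2 hhi) (hT.injOn him) ?_
    (fun a ha => hT.toothMap_notMem him ha) hI (fun i => ?_) hT.attach_mem hT.attach_inj
    (fun i hi' a ha => hT.attach_iff him hi' ha)
  · rintro ⟨x, y⟩ ⟨-, hx, hy⟩ ⟨x', y'⟩ ⟨-, hx', hy'⟩
    simp only at hx hy hx' hy'
    rw [combGraph_adj]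
    rcases Nat.eq_zero_or_pos y with rfl | hpos <;> rcases Nat.eq_zero_or_pos y' with rfl | hpos'
    · rw [toothMap_zero, toothMap_zero, hT.path.2 x (hx.trans him) x' (hx'.trans him)]
      omega
    · rw [toothMap_zero, toothMap_pos _ hpos',
        hroot _ (hT.mem_of_pos hpos' hy') _ hpos' hy' _ (hx.trans him)]
      omega
    · rw [toothMap_zero, toothMap_pos _ hpos, G.adj_comm,
        hroot _ (hT.mem_of_pos hpos hy) _ hpos hy _ (hx'.trans him)]
      omega
    · rw [toothMap_pos _ hpos, toothMap_pos _ hpos', hT.adj _ (hT.mem_of_pos hpos hy) _ hpos hy _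
        (hT.mem_of_pos hpos' hy') _ hpos' hy']
      omega
  · rw [hT.len_pos]
    exact ⟨fun h => ⟨(hb i h).1, (hb i h).2, h⟩, fun h => h.2.2⟩

theorem IsTeeth.outcome_of_triangular (hT : IsTeeth G S' m p I len t s) (hI : I.card = h)
    (hh : 1 < h) (hroot : ∀ x ∈ I, ∀ y, 0 < y → y ≤ len x → ∀ z ≤ m,
      (G.Adj (p z) (t x y) ↔ (z = x ∨ z = x + 1) ∧ y = 1)) : ConnectifierOutcome h G S' := by
  obtain ⟨lo, hlo, hi, hhi, hlt, hb⟩ := exists_lo_hi (hI ▸ hh)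
  have him := hT.le hi hhi
  refine outcome_of_combLine hlt ((hT.len_pos _).2 hlo) ((hT.len_pos _).2 hhi)
    ((hT.injOn him).mono Set.sdiff_subset) ?_
    (fun a ha => hT.toothMap_notMem him ha.1) hI (fun i => ?_) hT.attach_mem hT.attach_inj
    (fun i hi' a ha => hT.attach_iff him hi' ha.1)
  · rintro ⟨x, y⟩ ⟨⟨hl, hx, hy⟩, hne⟩ ⟨x', y'⟩ ⟨⟨hl', hx', hy'⟩, hne'⟩
    simp only [Set.mem_singleton_iff, Prod.mk.injEq] at hl hx hy hne hl' hx' hy' hne'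
    rw [combLineGraph_adj (by omega) (by omega)]
    rcases Nat.eq_zero_or_pos y with rfl | hpos <;> rcases Nat.eq_zero_or_pos y' with rfl | hpos'
    · rw [toothMap_zero, toothMap_zero, hT.path.2 x (hx.trans him) x' (hx'.trans him)]
      omega
    · rw [toothMap_zero, toothMap_pos _ hpos',
        hroot _ (hT.mem_of_pos hpos' hy') _ hpos' hy' _ (hx.trans him)]
      omega
    · rw [toothMap_zero, toothMap_pos _ hpos, G.adj_comm,
        hroot _ (hT.mem_of_pos hpos hy) _ hpos hy _ (hx'.trans him)]
      omega
    · rw [toothMap_pos _ hpos, toothMap_pos _ hpos', hT.adj _ (hT.mem_of_pos hpos hy) _ hpos hy _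
        (hT.mem_of_pos hpos' hy') _ hpos' hy']
      omega
  · rw [hT.len_pos]
    exact ⟨fun h => ⟨(hb i h).1, (hb i h).2, h⟩, fun h => h.2.2⟩

end Combs

section Legs

variable {V : Type} {G : SimpleGraph V} {B S X : Set V} {I : Finset ℕ} {u s : ℕ → V}
  {l : ℕ → ℕ} {q : ℕ → ℕ → V}

/-- Pairwise disjoint induced paths `q i 0, …, q i (l i)` in `B`, starting at vertices `u i`
with neighbors in `X`, and otherwise anticomplete to `X` and to each other, such that `s i ∈ S`
attaches exactly to the last vertex of the `i`-th path. -/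
structure IsLegSystem (G : SimpleGraph V) (B S X : Set V) (I : Finset ℕ) (u s : ℕ → V)
    (l : ℕ → ℕ) (q : ℕ → ℕ → V) : Prop where
  path : ∀ i ∈ I, IsSeqPath G (l i) (q i)
  start : ∀ i ∈ I, q i 0 = u i
  mem : ∀ i ∈ I, ∀ j ≤ l i, q i j ∈ B
  notMem : ∀ i ∈ I, ∀ j ≤ l i, q i j ∉ X
  adj_core : ∀ i ∈ I, ∀ j ≤ l i, ∀ x ∈ X, G.Adj (q i j) x → j = 0
  ne : ∀ i ∈ I, ∀ i' ∈ I, i ≠ i' → ∀ j ≤ l i, ∀ j' ≤ l i', q i j ≠ q i' j'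
  adj : ∀ i ∈ I, ∀ i' ∈ I, i ≠ i' → ∀ j ≤ l i, ∀ j' ≤ l i', G.Adj (q i j) (q i' j') →
    j = 0 ∧ j' = 0
  attach_mem : ∀ i ∈ I, s i ∈ S
  attach_core : ∀ i ∈ I, ∀ x ∈ X, ¬ G.Adj (s i) x
  attach : ∀ i ∈ I, ∀ j ≤ l i, (G.Adj (s i) (q i j) ↔ j = l i)
  attach_other : ∀ i ∈ I, ∀ i' ∈ I, i ≠ i' → ∀ j ≤ l i', ¬ G.Adj (s i) (q i' j)

theorem IsLegSystem.mono {J : Finset ℕ} (hL : IsLegSystem G B S X I u s l q) (hJ : J ⊆ I) :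
    IsLegSystem G B S X J u s l q where
  path i hi := hL.path i (hJ hi)
  start i hi := hL.start i (hJ hi)
  mem i hi := hL.mem i (hJ hi)
  notMem i hi := hL.notMem i (hJ hi)
  adj_core i hi := hL.adj_core i (hJ hi)
  ne i hi i' hi' := hL.ne i (hJ hi) i' (hJ hi')
  adj i hi i' hi' := hL.adj i (hJ hi) i' (hJ hi')
  attach_mem i hi := hL.attach_mem i (hJ hi)
  attach_core i hi := hL.attach_core i (hJ hi)
  attach i hi := hL.attach i (hJ hi)
  attach_other i hi i' hi' := hL.attach_other i (hJ hi) i' (hJ hi')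

theorem IsLegSystem.attach_inj (hL : IsLegSystem G B S X I u s l q) : Set.InjOn s I := by
  intro i hi i' hi' h
  by_contra hne
  refine hL.attach_other i hi i' hi' hne (l i') le_rfl ?_
  rw [h]
  exact (hL.attach i' hi' _ le_rfl).2 rfl

theorem IsLegSystem.adj_iff (hL : IsLegSystem G B S X I u s l q)
    (hu : ∀ i ∈ I, ∀ i' ∈ I, i ≠ i' → ¬ G.Adj (u i) (u i')) {i i' j j' : ℕ} (hi : i ∈ I)
    (hi' : i' ∈ I) (hj : j ≤ l i) (hj' : j' ≤ l i') :
    G.Adj (q i j) (q i' j') ↔ i = i' ∧ (j = j' + 1 ∨ j' = j + 1) := by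
  by_cases h : i = i'
  · subst h
    rw [(hL.path i hi).2 j hj j' hj']
    simp
  · refine iff_of_false (fun hadj => ?_) (fun h' => h h'.1)
    obtain ⟨rfl, rfl⟩ := hL.adj i hi i' hi' h j hj j' hj' hadj
    rw [hL.start i hi, hL.start i' hi'] at hadj
    exact hu i hi i' hi' h hadj

theorem IsLegSystem.inj (hL : IsLegSystem G B S X I u s l q) {i i' j j' : ℕ} (hi : i ∈ I)
    (hi' : i' ∈ I) (hj : j ≤ l i) (hj' : j' ≤ l i') (h : q i j = q i' j') : i = i' ∧ j = j' := by
  by_cases hne : i = i'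
  · subst hne
    exact ⟨rfl, (hL.path i hi).1 j hj j' hj' h⟩
  · exact absurd h (hL.ne i hi i' hi' hne j hj j' hj')

theorem IsLegSystem.attach_iff (hL : IsLegSystem G B S X I u s l q) {i i' j : ℕ} (hi : i ∈ I)
    (hi' : i' ∈ I) (hj : j ≤ l i') : G.Adj (s i) (q i' j) ↔ i' = i ∧ j = l i := by
  by_cases h : i' = i
  · subst h
    rw [hL.attach i' hi' j hj]
    simp
  · exact iff_of_false (hL.attach_other i hi i' hi' (Ne.symm h) j hj) (fun h' => h h'.1)

theorem IsLegSystem.core_adj_iff (hL : IsLegSystem G B S X I u s l q) {i j : ℕ} (hi : i ∈ I)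
    (hj : j ≤ l i) {x : V} (hx : x ∈ X) : G.Adj x (q i j) ↔ G.Adj x (u i) ∧ j = 0 := by
  constructor
  · intro h
    have hj0 := hL.adj_core i hi j hj x hx h.symm
    subst hj0
    exact ⟨hL.start i hi ▸ h, rfl⟩
  · rintro ⟨h, rfl⟩
    rwa [hL.start i hi]

theorem exists_isLegSystem [Finite V] (hB : ConnSet G B) (hX : ConnSet G X) (hXB : X ⊆ B)
    (hmin : ∀ R ⊂ B, ConnSet G R → ∃ s ∈ S, ∀ w ∈ R, ¬ G.Adj s w)
    (hatt : ∀ s ∈ S, ∃ w ∈ B, G.Adj s w) (huB : ∀ i ∈ I, u i ∈ B) (huX : ∀ i ∈ I, u i ∉ X)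
    (hu : Set.InjOn u I) (hux : ∀ i ∈ I, ∃ x ∈ X, G.Adj (u i) x) :
    ∃ s l q, IsLegSystem G B S X I u s l q := by
  have hD : ∀ i, ∃ D s, i ∈ I → HangsAt G B (u i) D ∧ Disjoint D X ∧ s ∈ S ∧
      ∀ w ∈ B, G.Adj s w → w ∈ D := by
    intro i
    by_cases hi : i ∈ I
    · obtain ⟨D, h1, h2, s, h3, h4⟩ := exists_hangsAt hB hX hXB (huB i hi) (huX i hi) hmin
      exact ⟨D, s, fun _ => ⟨h1, h2, h3, h4⟩⟩
    · exact ⟨∅, u i, fun h => absurd h hi⟩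
  choose D s hD using hD
  have hq : ∀ i, ∃ (l : ℕ) (q : ℕ → V), i ∈ I → IsSeqPath G l q ∧ q 0 = u i ∧
      (∀ j ≤ l, q j ∈ D i) ∧ ∀ j ≤ l, (G.Adj (s i) (q j) ↔ j = l) := by
    intro i
    by_cases hi : i ∈ I
    · obtain ⟨h1, h2, h3, h4⟩ := hD i hi
      obtain ⟨w, hw, hsw⟩ := hatt _ h3
      obtain ⟨l, q, hq⟩ := exists_isSeqPath h1.conn h1.mem (P := G.Adj (s i)) ⟨w, h4 w hw hsw, hsw⟩
      exact ⟨l, q, fun _ => hq⟩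
    · exact ⟨0, u, fun h => absurd h hi⟩
  choose l q hq using hq
  have hdisj : ∀ i ∈ I, ∀ i' ∈ I, i ≠ i' → Disjoint (D i) (D i') := by
    intro i hi i' hi' hne
    obtain ⟨x, hx, hux1⟩ := hux i hi
    obtain ⟨x', hx', hux2⟩ := hux i' hi'
    exact (hD i hi).1.disjoint hB hXB (hD i' hi').1 (hD i hi).2.1 (hD i' hi').2.1 hx hux1 hx' hux2
      (fun h => hne (hu hi hi' h))
  have hzero : ∀ i ∈ I, ∀ j ≤ l i, q i j = u i → j = 0 := fun i hi j hj h =>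
    (hq i hi).1.1 j hj 0 (Nat.zero_le _) (h.trans (hq i hi).2.1.symm)
  refine ⟨s, l, q, ?_⟩
  constructor
  · exact fun i hi => (hq i hi).1
  · exact fun i hi => (hq i hi).2.1
  · exact fun i hi j hj => (hD i hi).1.subset ((hq i hi).2.2.1 j hj)
  · exact fun i hi j hj => Set.disjoint_left.1 (hD i hi).2.1 ((hq i hi).2.2.1 j hj)
  · exact fun i hi j hj x hx hadj => hzero i hi j hj
      ((hD i hi).1.eq_of_adj hXB (hD i hi).2.1 ((hq i hi).2.2.1 j hj) hx hadj)
  · exact fun i hi i' hi' hne j hj j' hj' h => Set.disjoint_left.1 (hdisj i hi i' hi' hne)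
      ((hq i hi).2.2.1 j hj) (h ▸ (hq i' hi').2.2.1 j' hj')
  · intro i hi i' hi' hne j hj j' hj' hadj
    obtain ⟨h1, h2⟩ := (hD i hi).1.eq_and_eq_of_adj (hD i' hi').1 (hdisj i hi i' hi' hne)
      ((hq i hi).2.2.1 j hj) ((hq i' hi').2.2.1 j' hj') hadj
    exact ⟨hzero i hi j hj h1, hzero i' hi' j' hj' h2⟩
  · exact fun i hi => (hD i hi).2.2.1
  · exact fun i hi x hx hadj => Set.disjoint_left.1 (hD i hi).2.1
      ((hD i hi).2.2.2 x (hXB hx) hadj) hx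
  · exact fun i hi => (hq i hi).2.2.2
  · exact fun i hi i' hi' hne j hj hadj => Set.disjoint_left.1 (hdisj i hi i' hi' hne)
      ((hD i hi).2.2.2 _ ((hD i' hi').1.subset ((hq i' hi').2.2.1 j hj)) hadj)
      ((hq i' hi').2.2.1 j hj)

end Legs

section Branches

variable {V : Type} {G : SimpleGraph V} {B S' X : Set V} {I : Finset ℕ} {u s p : ℕ → V}
  {l : ℕ → ℕ} {q : ℕ → ℕ → V} {h m : ℕ}

theorem IsLegSystem.outcome_of_star {v : V} (hL : IsLegSystem G B S' {v} I u s l q)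
    (hBS : ∀ b ∈ B, b ∉ S') (hvB : v ∈ B) (hv : ∀ i ∈ I, G.Adj v (u i))
    (hu : ∀ i ∈ I, ∀ i' ∈ I, i ≠ i' → ¬ G.Adj (u i) (u i')) (hI : I.card = h) (hh : 2 < h) :
    ConnectifierOutcome h G S' := by
  have hcore : ∀ i ∈ I, ∀ j ≤ l i, (G.Adj v (q i j) ↔ j = 0) := fun i hi j hj => by
    rw [hL.core_adj_iff hi hj rfl, and_iff_right (hv i hi)]
  refine _root_.outcome_of_star (I := I) (len := fun x => l x + 1)
    (F := fun a => if a.2 = 0 then v else q a.1 (a.2 - 1)) hI hh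
    (fun _ _ => Nat.succ_pos _) ?_ ?_ ?_ hL.attach_mem hL.attach_inj ?_
  · rintro ⟨x, y⟩ hxy ⟨x', y'⟩ hxy' heq
    simp only [spiderSet, Set.mem_ofPred_eq, Prod.mk.injEq] at hxy hxy' heq ⊢
    rcases hxy with ⟨rfl, rfl⟩ | ⟨hx, hy, hyl⟩ <;> rcases hxy' with ⟨rfl, rfl⟩ | ⟨hx', hy', hyl'⟩
    · exact ⟨rfl, rfl⟩
    · rw [if_pos rfl, if_neg hy'.ne'] at heq
      exact absurd heq.symm (hL.notMem _ hx' _ (by omega))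
    · rw [if_pos rfl, if_neg hy.ne'] at heq
      exact absurd heq (hL.notMem _ hx _ (by omega))
    · rw [if_neg hy.ne', if_neg hy'.ne'] at heq
      have := hL.inj hx hx' (by omega) (by omega) heq
      omega
  · rintro ⟨x, y⟩ hxy ⟨x', y'⟩ hxy'
    simp only [spiderSet, Set.mem_ofPred_eq, Prod.mk.injEq] at hxy hxy' ⊢
    rcases hxy with ⟨rfl, rfl⟩ | ⟨hx, hy, hyl⟩ <;> rcases hxy' with ⟨rfl, rfl⟩ | ⟨hx', hy', hyl'⟩
    · simp
    · rw [if_pos rfl, if_neg hy'.ne', spiderGraph_adj_root hy', hcore _ hx' _ (by omega)]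
      omega
    · rw [if_pos rfl, if_neg hy.ne', G.adj_comm, spiderGraph.adj_comm, spiderGraph_adj_root hy,
        hcore _ hx _ (by omega)]
      omega
    · rw [if_neg hy.ne', if_neg hy'.ne', spiderGraph_adj hy hy',
        hL.adj_iff hu hx hx' (by omega) (by omega)]
      omega
  · rintro ⟨x, y⟩ hxy
    simp only [spiderSet, Set.mem_ofPred_eq, Prod.mk.injEq] at hxy ⊢
    rcases hxy with ⟨rfl, rfl⟩ | ⟨hx, hy, hyl⟩
    · exact hBS v hvB
    · rw [if_neg hy.ne']
      exact hBS _ (hL.mem _ hx _ (by omega))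
  · rintro i hi ⟨x, y⟩ hxy
    simp only [spiderSet, Set.mem_ofPred_eq, Prod.mk.injEq] at hxy ⊢
    rcases hxy with ⟨rfl, rfl⟩ | ⟨hx, hy, hyl⟩
    · rw [if_pos rfl]
      exact iff_of_false (hL.attach_core i hi v rfl) (by omega)
    · rw [if_neg hy.ne', hL.attach_iff hi hx (by omega)]
      omega

/-- A leg system attached to a path gives teeth for that path. -/
theorem IsLegSystem.isTeeth (hL : IsLegSystem G B S' (p '' Set.Iic m) I u s l q)
    (hBS : ∀ b ∈ B, b ∉ S') (hp : IsSeqPath G m p) (hpB : ∀ i ≤ m, p i ∈ B)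
    (hu : ∀ i ∈ I, ∀ i' ∈ I, i ≠ i' → ¬ G.Adj (u i) (u i')) (hIm : ∀ i ∈ I, i ≤ m) :
    IsTeeth G S' m p I (fun x => if x ∈ I then l x + 1 else 0) (fun x y => q x (y - 1)) s where
  path := hp
  path_notMem x hx := hBS _ (hpB x hx)
  le := hIm
  len_pos x := by split_ifs with hx <;> simp [hx]
  notMem x hx y hy hyl := by
    rw [if_pos hx] at hyl
    exact hBS _ (hL.mem x hx _ (by omega))
  ne x hx y hy hyl z hz heq := by
    rw [if_pos hx] at hyl
    exact hL.notMem x hx (y - 1) (by omega) ⟨z, hz, heq.symm⟩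
  inj x hx y hy hyl x' hx' y' hy' hyl' heq := by
    rw [if_pos hx] at hyl
    rw [if_pos hx'] at hyl'
    have := hL.inj hx hx' (by omega) (by omega) heq
    omega
  adj x hx y hy hyl x' hx' y' hy' hyl' := by
    rw [if_pos hx] at hyl
    rw [if_pos hx'] at hyl'
    rw [hL.adj_iff hu hx hx' (by omega) (by omega)]
    omega
  attach_mem := hL.attach_mem
  attach_inj := hL.attach_inj
  attach_path x hx z hz := hL.attach_core x hx _ ⟨z, hz, rfl⟩
  attach x hx x' hx' y hy hyl := by
    rw [if_pos hx'] at hyl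
    rw [if_pos hx, hL.attach_iff hx hx' (by omega)]
    omega

theorem IsLegSystem.outcome_of_one (hL : IsLegSystem G B S' (p '' Set.Iic m) I u s l q)
    (hBS : ∀ b ∈ B, b ∉ S') (hp : IsSeqPath G m p) (hpB : ∀ i ≤ m, p i ∈ B)
    (hu : ∀ i ∈ I, ∀ i' ∈ I, i ≠ i' → ¬ G.Adj (u i) (u i')) (hIm : ∀ i ∈ I, i ≤ m)
    (hup : ∀ i ∈ I, ∀ z ≤ m, (G.Adj (p z) (u i) ↔ z = i)) (hI : I.card = h) (hh : 1 < h) :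
    ConnectifierOutcome h G S' :=
  (hL.isTeeth hBS hp hpB hu hIm).outcome_of_spiky hI hh fun x hx y hy hyl z hz => by
    rw [if_pos hx] at hyl
    rw [hL.core_adj_iff hx (by omega) ⟨z, hz, rfl⟩, hup x hx z hz]
    omega

theorem IsLegSystem.outcome_of_two (hL : IsLegSystem G B S' (p '' Set.Iic m) I u s l q)
    (hBS : ∀ b ∈ B, b ∉ S') (hp : IsSeqPath G m p) (hpB : ∀ i ≤ m, p i ∈ B)
    (hu : ∀ i ∈ I, ∀ i' ∈ I, i ≠ i' → ¬ G.Adj (u i) (u i')) (hIm : ∀ i ∈ I, i ≤ m)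
    (hup : ∀ i ∈ I, ∀ z ≤ m, (G.Adj (p z) (u i) ↔ z = i ∨ z = i + 1)) (hI : I.card = h)
    (hh : 1 < h) : ConnectifierOutcome h G S' :=
  (hL.isTeeth hBS hp hpB hu hIm).outcome_of_triangular hI hh fun x hx y hy hyl z hz => by
    rw [if_pos hx] at hyl
    rw [hL.core_adj_iff hx (by omega) ⟨z, hz, rfl⟩, hup x hx z hz]
    omega

/-- The sequence `p` with its entries at `i + 1` for `i ∈ I` replaced by `u i`. -/
def reroute (p u : ℕ → V) (I : Finset ℕ) (j : ℕ) : V := if 0 < j ∧ j - 1 ∈ I then u (j - 1) else p j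

theorem reroute_succ {i : ℕ} (hi : i ∈ I) : reroute p u I (i + 1) = u i :=
  if_pos ⟨Nat.succ_pos i, hi⟩

theorem reroute_of_notMem {j : ℕ} (hj : ¬ (0 < j ∧ j - 1 ∈ I)) : reroute p u I j = p j :=
  if_neg hj

theorem reroute_cases (p u : ℕ → V) (I : Finset ℕ) (j : ℕ) :
    (∃ i ∈ I, j = i + 1 ∧ reroute p u I j = u i) ∨
      (∀ i ∈ I, j ≠ i + 1) ∧ reroute p u I j = p j := by
  by_cases hj : 0 < j ∧ j - 1 ∈ I
  · exact Or.inl ⟨j - 1, hj.2, by omega, if_pos hj⟩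
  · refine Or.inr ⟨fun i hi h => hj ?_, if_neg hj⟩
    subst h
    exact ⟨Nat.succ_pos i, hi⟩

/-- Moving the first vertex of each leg to the path. -/
theorem IsLegSystem.reroute (hL : IsLegSystem G B S' (p '' Set.Iic m) I u s l q)
    (hu : ∀ i ∈ I, ∀ i' ∈ I, i ≠ i' → ¬ G.Adj (u i) (u i')) (hl : ∀ i ∈ I, 0 < l i) :
    IsLegSystem G B S' (reroute p u I '' Set.Iic m) (I.image (· + 1)) (fun x => q (x - 1) 1)
      (fun x => s (x - 1)) (fun x => l (x - 1) - 1) (fun x j => q (x - 1) (j + 1)) := by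
  have hmem : ∀ {x}, x ∈ I.image (· + 1) → x - 1 ∈ I ∧ 0 < x := by
    intro x hx
    obtain ⟨i, hi, rfl⟩ := Finset.mem_image.1 hx
    exact ⟨hi, Nat.succ_pos i⟩
  constructor
  · intro x hx
    have hi := (hmem hx).1
    have hl' := hl _ hi
    have h := hL.path _ hi
    refine ⟨fun i hi j hj heq => ?_, fun i hi j hj => ?_⟩
    · have := h.1 _ (by omega) _ (by omega) heq
      omega
    · rw [h.2 _ (by omega) _ (by omega)]
      omega
  · intro x _
    rfl
  · intro x hx j hj
    have hl' := hl _ (hmem hx).1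
    exact hL.mem _ (hmem hx).1 _ (by omega)
  · rintro x hx j hj ⟨z, hz, heq⟩
    have hi := (hmem hx).1
    have hl' := hl _ hi
    rcases reroute_cases p u I z with ⟨i, hiI, -, h⟩ | ⟨-, h⟩
    · rw [h, ← hL.start i hiI] at heq
      have := hL.inj hiI hi (Nat.zero_le _) (by omega) heq
      omega
    · exact hL.notMem _ hi _ (by omega) ⟨z, hz, h ▸ heq⟩
  · rintro x hx j hj _ ⟨z, hz, rfl⟩ hadj
    have hi := (hmem hx).1
    have hl' := hl _ hi
    rcases reroute_cases p u I z with ⟨i, hiI, -, h⟩ | ⟨-, h⟩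
    · rw [h, ← hL.start i hiI, hL.adj_iff hu hi hiI (by omega) (Nat.zero_le _)] at hadj
      omega
    · have := hL.adj_core _ hi _ (by omega) _ ⟨z, hz, rfl⟩ (h ▸ hadj)
      omega
  · intro x hx x' hx' hne j hj j' hj' heq
    have h1 := hmem hx
    have h2 := hmem hx'
    have hl1 := hl _ h1.1
    have hl2 := hl _ h2.1
    have := hL.inj h1.1 h2.1 (by omega) (by omega) heq
    omega
  · intro x hx x' hx' hne j hj j' hj' hadj
    have h1 := hmem hx
    have h2 := hmem hx'
    have hl1 := hl _ h1.1
    have hl2 := hl _ h2.1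
    rw [hL.adj_iff hu h1.1 h2.1 (by omega) (by omega)] at hadj
    omega
  · exact fun x hx => hL.attach_mem _ (hmem hx).1
  · rintro x hx _ ⟨z, hz, rfl⟩ hadj
    have hi := (hmem hx).1
    have hl' := hl _ hi
    rcases reroute_cases p u I z with ⟨i, hiI, -, h⟩ | ⟨-, h⟩
    · rw [h, ← hL.start i hiI, hL.attach_iff hi hiI (Nat.zero_le _)] at hadj
      obtain ⟨rfl, h0⟩ := hadj
      omega
    · exact hL.attach_core _ hi _ ⟨z, hz, rfl⟩ (h ▸ hadj)
  · intro x hx j hj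
    have hi := (hmem hx).1
    have hl' := hl _ hi
    rw [hL.attach _ hi _ (by omega)]
    omega
  · intro x hx x' hx' hne j hj
    have h1 := hmem hx
    have h2 := hmem hx'
    have hl2 := hl _ h2.1
    rw [hL.attach_iff h1.1 h2.1 (by omega)]
    omega

theorem IsLegSystem.outcome_of_reroute_zero
    (hL : IsLegSystem G B S' (p '' Set.Iic m) I u s l q) (hBS : ∀ b ∈ B, b ∉ S')
    (hp : IsSeqPath G m (_root_.reroute p u I)) (hpB : ∀ i ≤ m, p i ∈ B)
    (hIm : ∀ i ∈ I, i + 1 ≤ m) (hl : ∀ i ∈ I, l i = 0) (hI : I.card = h) :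
    ConnectifierOutcome h G S' := by
  refine outcome_of_path hp (fun j hj => hBS _ ?_) hI hL.attach_inj hL.attach_mem
    (fun i hi => ⟨i + 1, hIm i hi, ?_⟩)
  · rcases reroute_cases p u I j with ⟨i, hiI, -, h⟩ | ⟨-, h⟩
    · rw [h, ← hL.start i hiI]
      exact hL.mem i hiI 0 (Nat.zero_le _)
    · rw [h]
      exact hpB j hj
  · rw [reroute_succ hi, ← hL.start i hi]
    exact (hL.attach i hi 0 (Nat.zero_le _)).2 (hl i hi).symm

theorem IsLegSystem.outcome_of_reroute_pos
    (hL : IsLegSystem G B S' (p '' Set.Iic m) I u s l q) (hBS : ∀ b ∈ B, b ∉ S')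
    (hp : IsSeqPath G m (_root_.reroute p u I)) (hpB : ∀ i ≤ m, p i ∈ B)
    (hu : ∀ i ∈ I, ∀ i' ∈ I, i ≠ i' → ¬ G.Adj (u i) (u i'))
    (hIm : ∀ i ∈ I, i + 1 ≤ m) (hl : ∀ i ∈ I, 0 < l i) (hI : I.card = h) (hh : 1 < h) :
    ConnectifierOutcome h G S' := by
  have hmem : ∀ {x}, x ∈ I.image (· + 1) → x - 1 ∈ I ∧ 0 < x := by
    intro x hx
    obtain ⟨i, hi, rfl⟩ := Finset.mem_image.1 hx
    exact ⟨hi, Nat.succ_pos i⟩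
  refine (hL.reroute hu hl).outcome_of_one hBS hp (fun j hj => ?_) (fun x hx x' hx' hne => ?_)
    (fun x hx => ?_) (fun x hx z hz => ?_)
    ((Finset.card_image_of_injective I (add_left_injective 1)).trans hI) hh
  · rcases reroute_cases p u I j with ⟨i, hiI, -, h⟩ | ⟨-, h⟩
    · rw [h, ← hL.start i hiI]
      exact hL.mem i hiI 0 (Nat.zero_le _)
    · rw [h]
      exact hpB j hj
  · have h1 := hmem hx
    have h2 := hmem hx'
    rw [hL.adj_iff hu h1.1 h2.1 (hl _ h1.1) (hl _ h2.1)]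
    omega
  · have h1 := hmem hx
    have := hIm _ h1.1
    omega
  · have h1 := hmem hx
    rcases reroute_cases p u I z with ⟨i, hiI, hz', h⟩ | ⟨hz', h⟩
    · rw [h, ← hL.start i hiI, hL.adj_iff hu hiI h1.1 (Nat.zero_le _) (hl _ h1.1)]
      omega
    · rw [h, hL.core_adj_iff h1.1 (hl _ h1.1) ⟨z, hz, rfl⟩]
      refine iff_of_false (fun h => one_ne_zero h.2) (fun hzx => hz' _ h1.1 ?_)
      omega

end Branches

section Assembly

variable {V : Type} {G : SimpleGraph V} {B S' : Set V} {h m : ℕ}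

theorem exists_enum [Nonempty V] (c : Finset V) :
    ∃ u : ℕ → V, Set.InjOn u (Finset.range c.card) ∧ ∀ i ∈ Finset.range c.card, u i ∈ c := by
  have e := c.equivFin.symm
  refine ⟨fun i => if hi : i < c.card then e ⟨i, hi⟩ else Classical.arbitrary V, ?_, ?_⟩
  · intro i hi j hj hij
    have hi := Finset.mem_range.1 hi
    have hj := Finset.mem_range.1 hj
    simp only [dif_pos hi, dif_pos hj] at hij
    simpa using e.injective (Subtype.ext hij)
  · intro i hi
    have hi := Finset.mem_range.1 hi
    simp only [dif_pos hi]
    exact (e _).2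

theorem outcome_of_stable_nbrs [Finite V] (hB : ConnSet G B)
    (hmin : ∀ R ⊂ B, ConnSet G R → ∃ s ∈ S', ∀ w ∈ R, ¬ G.Adj s w)
    (hatt : ∀ s ∈ S', ∃ w ∈ B, G.Adj s w) (hBS : ∀ b ∈ B, b ∉ S') {v : V} (hv : v ∈ B)
    {c : Finset V} (hcB : ∀ x ∈ c, x ∈ B) (hcv : ∀ x ∈ c, G.Adj v x)
    (hst : StableSet G (c : Set V)) (hc : c.card = h) (hh : 2 < h) :
    ConnectifierOutcome h G S' := by
  have : Nonempty V := ⟨v⟩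
  obtain ⟨u, hu, huc⟩ := exists_enum c
  obtain ⟨s, l, q, hL⟩ := exists_isLegSystem (S := S') (X := {v}) hB (connSet_singleton v)
    (Set.singleton_subset_iff.2 hv) hmin hatt (fun i hi => hcB _ (huc i hi))
    (fun i hi => (hcv _ (huc i hi)).ne') hu (fun i hi => ⟨v, rfl, (hcv _ (huc i hi)).symm⟩)
  exact hL.outcome_of_star hBS hv (fun i hi => hcv _ (huc i hi))
    (fun i hi i' hi' hne => hst _ (huc i hi) _ (huc i' hi') (fun he => hne (hu hi hi' he)))
    ((Finset.card_range _).trans hc) hh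

theorem connSet_image_Iic {p : ℕ → V} (hp : ∀ i < m, G.Adj (p i) (p (i + 1))) :
    ConnSet G (p '' Set.Iic m) := by
  induction m with
  | zero =>
    convert connSet_singleton (G := G) (p 0) using 1
    ext x
    simp [eq_comm]
  | succ n ih =>
    have := (ih fun i hi => hp i (by omega)).insert (x := p n) (y := p (n + 1))
      ⟨n, Set.mem_Iic.2 le_rfl, rfl⟩ (hp n (by omega))
    rwa [← Set.image_insert_eq, ← Order.succ_eq_add_one, ← Order.Iic_succ] at this

theorem IsSeqPath.of_induce {p : ℕ → B} (hp : IsSeqPath (G.induce B) m p) :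
    IsSeqPath G m (fun i => (p i : V)) :=
  ⟨fun i hi j hj hij => hp.1 i hi j hj (Subtype.ext hij), hp.2⟩

theorem dist_of_isChild {W : Type} {H : SimpleGraph W} {p : ℕ → W}
    (hp : ∀ i < m, IsChild H (p 0) (p i) (p (i + 1))) : ∀ i ≤ m, H.dist (p 0) (p i) = i := by
  intro i
  induction i with
  | zero => simp
  | succ n ih =>
    intro hn
    rw [(hp n hn).2, ih (by omega)]

theorem dist_le_of_adj {W : Type} {H : SimpleGraph W} (hH : H.Connected) {r v w : W}
    (hvw : H.Adj v w) : H.dist r v ≤ H.dist r w + 1 := by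
  have := hH.dist_triangle (u := r) (v := w) (w := v)
  rwa [dist_eq_one_iff_adj.2 hvw.symm] at this

theorem exists_spread_subset (U : Finset ℕ) (color : ℕ → ℕ) (hcolor : ∀ i ∈ U, color i < 5)
    (hU : 20 * h ≤ U.card) : ∃ I ⊆ U, I.card = h ∧
      (∀ i ∈ I, ∀ j ∈ I, i ≠ j → i + 4 ≤ j ∨ j + 4 ≤ i) ∧ ∃ k < 5, ∀ i ∈ I, color i = k := by
  obtain ⟨⟨a, k⟩, hak, hcard⟩ := Finset.exists_le_card_fiber_of_mul_le_card_of_maps_to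
    (s := U) (t := Finset.range 4 ×ˢ Finset.range 5) (f := fun i => (i % 4, color i)) (n := h)
    (fun i hi => Finset.mem_product.2 ⟨Finset.mem_range.2 (Nat.mod_lt _ (by norm_num)),
      Finset.mem_range.2 (hcolor i hi)⟩) ⟨(0, 0), by simp⟩ (by simpa using hU)
  obtain ⟨I, hI, hIc⟩ := Finset.exists_subset_card_eq hcard
  have hI' : ∀ i ∈ I, i ∈ U ∧ i % 4 = a ∧ color i = k := fun i hi => by
    simpa using Finset.mem_filter.1 (hI hi)
  refine ⟨I, fun i hi => (hI' i hi).1, hIc, fun i hi j hj hne => ?_, k, ?_,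
    fun i hi => (hI' i hi).2.2⟩
  · have h1 := (hI' i hi).2.1
    have h2 := (hI' j hj).2.1
    omega
  · simpa using (Finset.mem_product.1 hak).2

theorem outcome_of_useful_path [Finite V] (hB : ConnSet G B)
    (hmin : ∀ R ⊂ B, ConnSet G R → ∃ s ∈ S', ∀ w ∈ R, ¬ G.Adj s w) (hBS : ∀ b ∈ B, b ∉ S')
    (hh : 1 < h) {y : V → B} (hy : ∀ s ∈ S', G.Adj s (y s)) {p : ℕ → B}
    (hp : ∀ i < m, IsChild (G.induce B) (p 0) (p i) (p (i + 1))) {U : Finset ℕ}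
    (hU : 20 * h ≤ U.card) (hU' : ∀ i ∈ U, i ≤ m ∧ ((∃ s ∈ S', y s = p i) ∨
      (i < m ∧ ∃ u, IsChild (G.induce B) (p 0) (p i) u ∧ u ≠ p (i + 1)))) :
    ConnectifierOutcome h G S' := by
  classical
  have hd := dist_of_isChild hp
  have hP : IsSeqPath (G.induce B) m p := isSeqPath_of_dist hB (fun i hi => (hp i hi).1) hd
  let J := U.filter fun i => ¬ ∃ s ∈ S', y s = p i
  have hJ : ∀ i ∈ J, i < m ∧ ∃ u, IsChild (G.induce B) (p 0) (p i) u ∧ u ≠ p (i + 1) :=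
    fun i hi => (hU' i (Finset.mem_filter.1 hi).1).2.resolve_left (Finset.mem_filter.1 hi).2
  have hu : ∀ i, ∃ u, i ∈ J → IsChild (G.induce B) (p 0) (p i) u ∧ u ≠ p (i + 1) := fun i => by
    by_cases hi : i ∈ J
    · exact (hJ i hi).2.imp fun u hu _ => hu
    · exact ⟨p 0, fun h => absurd h hi⟩
  choose u hu using hu
  have hud : ∀ i ∈ J, (G.induce B).dist (p 0) (u i) = i + 1 := fun i hi => by
    rw [(hu i hi).1.2, hd i (hJ i hi).1.le]
  have hup : ∀ i ∈ J, ∀ z ≤ m, u i ≠ p z := fun i hi z hz heq => by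
    have h1 := hud i hi
    rw [heq, hd z hz] at h1
    exact (hu i hi).2 (h1 ▸ heq)
  have hnear : ∀ i ∈ J, ∀ z ≤ m, G.Adj (p z) (u i) → i ≤ z ∧ z ≤ i + 2 := by
    intro i hi z hz hadj
    have h1 := dist_le_of_adj hB (r := p 0) (v := p z) (w := u i) hadj
    have h2 := dist_le_of_adj hB (r := p 0) (v := u i) (w := p z) hadj.symm
    rw [hud i hi, hd z hz] at h1 h2
    omega
  have hadj_self : ∀ i ∈ J, G.Adj (p i) (u i) := fun i hi => (hu i hi).1.1
  have huinj : Set.InjOn (fun i => (u i : V)) J := fun i hi j hj hij => by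
    have h1 := hud i hi
    rw [Subtype.ext hij, hud j hj] at h1
    omega
  have hunadj : ∀ i ∈ J, ∀ j ∈ J, i + 4 ≤ j ∨ j + 4 ≤ i → ¬ G.Adj (u i) (u j) := by
    intro i hi j hj hij hadj
    have h1 := dist_le_of_adj hB (r := p 0) (v := u i) (w := u j) hadj
    have h2 := dist_le_of_adj hB (r := p 0) (v := u j) (w := u i) hadj.symm
    rw [hud i hi, hud j hj] at h1 h2
    omega
  obtain ⟨s, l, q, hL⟩ := exists_isLegSystem (S := S') (X := (fun i => (p i : V)) '' Set.Iic m)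
    (I := J) (u := fun i => (u i : V)) hB (connSet_image_Iic fun i hi => (hp i hi).1)
    (by rintro _ ⟨i, -, rfl⟩; exact (p i).2) hmin (fun s hs => ⟨y s, (y s).2, hy s hs⟩)
    (fun i _ => (u i).2)
    (by rintro i hi ⟨z, hz, heq⟩; exact hup i hi z hz (Subtype.ext heq.symm)) huinj
    (fun i hi => ⟨p i, ⟨i, (hJ i hi).1.le, rfl⟩, (hadj_self i hi).symm⟩)
  let color : ℕ → ℕ := fun i => if i ∈ J then
    if i + 2 ≤ m ∧ G.Adj (p (i + 2)) (u i) then (if l i = 0 then 3 else 4)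
    else if G.Adj (p (i + 1)) (u i) then 2 else 1 else 0
  obtain ⟨I, hIU, hI, hfar, k, hk, hcol⟩ := exists_spread_subset U color
    (fun i _ => by simp only [color]; split_ifs <;> norm_num) hU
  by_cases hk0 : k = 0
  · subst hk0
    have hA : ∀ i, ∃ s, i ∈ I → s ∈ S' ∧ y s = p i := fun i => by
      by_cases hi : i ∈ I
      · have hiJ : i ∉ J := fun hiJ => by
          have := hcol i hi
          simp only [color, if_pos hiJ] at this
          split_ifs at this
        simp only [J, Finset.mem_filter, not_and, not_not] at hiJ
        exact (hiJ (hIU hi)).imp fun s hs _ => hs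
      · exact ⟨p 0, fun h => absurd h hi⟩
    choose a ha using hA
    refine outcome_of_path hP.of_induce (fun i _ => hBS _ (p i).2) hI (s := a) ?_
      (fun i hi => (ha i hi).1)
      (fun i hi => ⟨i, (hU' i (hIU hi)).1, (ha i hi).2 ▸ hy _ (ha i hi).1⟩)
    intro i hi j hj hij
    refine hP.1 i (hU' i (hIU hi)).1 j (hU' j (hIU hj)).1 ?_
    rw [← (ha i hi).2, ← (ha j hj).2, hij]
  have hIJ : I ⊆ J := fun i hi => by
    by_contra hiJ
    have := hcol i hi
    simp only [color, if_neg hiJ] at this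
    exact hk0 this.symm
  have hLI := hL.mono hIJ
  have hpB : ∀ i ≤ m, (p i : V) ∈ B := fun i _ => (p i).2
  have hIu : ∀ i ∈ I, ∀ j ∈ I, i ≠ j → ¬ G.Adj (u i) (u j) := fun i hi j hj hne =>
    hunadj i (hIJ hi) j (hIJ hj) (hfar i hi j hj hne)
  have hIm : ∀ i ∈ I, i + 1 ≤ m := fun i hi => (hJ i (hIJ hi)).1
  have hIm' : ∀ i ∈ I, i ≤ m := fun i hi => (hJ i (hIJ hi)).1.le
  have hcol' : ∀ i ∈ I, (if i + 2 ≤ m ∧ G.Adj (p (i + 2)) (u i) then (if l i = 0 then 3 else 4)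
      else if G.Adj (p (i + 1)) (u i) then 2 else 1) = k := fun i hi => by
    rw [← hcol i hi]
    simp only [color, if_pos (hIJ hi)]
  by_cases hk3 : 3 ≤ k
  · have hI2 : ∀ i ∈ I, i + 2 ≤ m ∧ G.Adj (p (i + 2)) (u i) := fun i hi => by
      by_contra hn
      have := hcol' i hi
      rw [if_neg hn] at this
      split_ifs at this <;> omega
    have hR : IsSeqPath G m (reroute (fun i => (p i : V)) (fun i => (u i : V)) I) := by
      have : IsSeqPath (G.induce B) m (reroute p u I) := by
        refine isSeqPath_of_dist (r := p 0) hB (fun j hj => ?_) (fun j hj => ?_)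
        · rcases reroute_cases p u I j with ⟨i, hi, rfl, h⟩ | ⟨hj1, h⟩
          · rw [h, reroute_of_notMem fun hn => ?_]
            · exact (hI2 i hi).2.symm
            · have := hfar _ hn.2 _ hi
              omega
          · rcases reroute_cases p u I (j + 1) with ⟨i, hi, hij, h'⟩ | ⟨hj2, h'⟩
            · obtain rfl : j = i := by omega
              rw [h, h']
              exact hadj_self j (hIJ hi)
            · rw [h, h']
              exact (hp j hj).1
        · rcases reroute_cases p u I j with ⟨i, hi, rfl, h⟩ | ⟨-, h⟩
          · rw [h, hud i (hIJ hi)]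
          · rw [h, hd j hj]
      have h' := this.of_induce
      have he : (fun i => ((reroute p u I i : B) : V)) =
          reroute (fun i => (p i : V)) (fun i => (u i : V)) I := by
        funext i
        exact apply_ite _ _ _ _
      rwa [he] at h'
    by_cases hk4 : k = 3
    · refine hLI.outcome_of_reroute_zero hBS hR hpB hIm (fun i hi => ?_) hI
      have := hcol' i hi
      rw [if_pos (hI2 i hi), hk4] at this
      by_contra hl
      rw [if_neg hl] at this
      omega
    · refine hLI.outcome_of_reroute_pos hBS hR hpB hIu hIm (fun i hi => ?_) hI hh
      have := hcol' i hi
      rw [if_pos (hI2 i hi)] at this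
      by_contra hl
      rw [if_pos (by omega)] at this
      omega
  · have hI2 : ∀ i ∈ I, ¬ (i + 2 ≤ m ∧ G.Adj (p (i + 2)) (u i)) := fun i hi hn => by
      have := hcol' i hi
      rw [if_pos hn] at this
      split_ifs at this <;> omega
    have hcol2 : ∀ i ∈ I, (if G.Adj (p (i + 1)) (u i) then 2 else 1) = k := fun i hi => by
      rw [← hcol' i hi, if_neg (hI2 i hi)]
    have hz : ∀ i ∈ I, ∀ z ≤ m, G.Adj (p z) (u i) → z = i ∨ z = i + 1 := fun i hi z hz hadj => by
      have h1 := hnear i (hIJ hi) z hz hadj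
      by_contra hn
      obtain rfl : z = i + 2 := by omega
      exact hI2 i hi ⟨hz, hadj⟩
    by_cases hk1 : k = 1
    · refine hLI.outcome_of_one hBS hP.of_induce hpB hIu hIm' (fun i hi z hzm => ⟨fun hadj => ?_, ?_⟩)
        hI hh
      · refine (hz i hi z hzm hadj).resolve_right fun h => ?_
        subst h
        have := hcol2 i hi
        rw [if_pos hadj] at this
        omega
      · rintro rfl
        exact hadj_self z (hIJ hi)
    · refine hLI.outcome_of_two hBS hP.of_induce hpB hIu hIm' (fun i hi z hzm => ⟨hz i hi z hzm, ?_⟩)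
        hI hh
      rintro (rfl | rfl)
      · exact hadj_self z (hIJ hi)
      · have := hcol2 i hi
        by_contra hn
        rw [if_neg hn] at this
        exact hk1 this.symm

end Assembly

theorem exists_minimal_attachment {V : Type} [Finite V] {G : SimpleGraph V} {S' : Set V}
    (hconn : ConnSet G (Set.univ \ S')) (hatt : ∀ s ∈ S', ∃ w : V, w ∉ S' ∧ G.Adj s w) :
    ∃ B, (∀ b ∈ B, b ∉ S') ∧ ConnSet G B ∧ (∀ s ∈ S', ∃ w ∈ B, G.Adj s w) ∧
      ∀ R ⊂ B, ConnSet G R → ∃ s ∈ S', ∀ w ∈ R, ¬ G.Adj s w := by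
  obtain ⟨B, ⟨hBS, hB, hBatt⟩, hmin⟩ := (wellFounded_lt (α := Set V)).has_min
    {B | (∀ b ∈ B, b ∉ S') ∧ ConnSet G B ∧ ∀ s ∈ S', ∃ w ∈ B, G.Adj s w}
    ⟨Set.univ \ S', fun _ hb => hb.2, hconn,
      fun s hs => (hatt s hs).imp fun w hw => ⟨⟨trivial, hw.1⟩, hw.2⟩⟩
  refine ⟨B, hBS, hB, hBatt, fun R hR hRc => ?_⟩
  by_contra! hn
  exact hmin R ⟨fun b hb => hBS b (hR.1 hb), hRc, hn⟩ hR

theorem outcome_of_heavy {V : Type} [Fintype V] {G : SimpleGraph V} {S' : Set V} {h n : ℕ}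
    (hh : 2 < h) (hn : ∀ (V : Type) (G : SimpleGraph V) (t : Finset V), n ≤ t.card →
      (∃ c ⊆ t, c.card = h ∧ G.IsClique (c : Set V)) ∨
        ∃ c ⊆ t, c.card = h ∧ StableSet G (c : Set V)) (hfree : G.CliqueFree h)
    (hcard : heavyBound n h (20 * h) ≤ S'.ncard) (hconn : ConnSet G (Set.univ \ S'))
    (hatt : ∀ s ∈ S', ∃ w : V, w ∉ S' ∧ G.Adj s w) : ConnectifierOutcome h G S' := by
  classical
  obtain ⟨B, hBS, hB, hBatt, hmin⟩ := exists_minimal_attachment hconn hatt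
  by_contra hno
  have hy : ∀ s, ∃ w : B, s ∈ S' → G.Adj s w := fun s => by
    by_cases hs : s ∈ S'
    · obtain ⟨w, hw, hsw⟩ := hBatt s hs
      exact ⟨⟨w, hw⟩, fun _ => hsw⟩
    · obtain ⟨w, hw⟩ := hB.nonempty
      exact ⟨⟨w, hw⟩, fun h => absurd h hs⟩
  choose y hy using hy
  have hdeg : ∀ v : B, ∀ t : Finset B, (∀ u ∈ t, (G.induce B).Adj v u) → t.card ≤ n := by
    intro v t ht
    by_contra! hlt
    have hmem : ∀ x ∈ t.map (Function.Embedding.subtype _), x ∈ B ∧ G.Adj v x := by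
      intro x hx
      obtain ⟨w, hw, rfl⟩ := Finset.mem_map.1 hx
      exact ⟨w.2, ht w hw⟩
    rcases hn V G (t.map (Function.Embedding.subtype _)) (by simpa using hlt.le) with
      ⟨c, -, hc, hcl⟩ | ⟨c, hct, hc, hst⟩
    · exact hfree c ⟨hcl, hc⟩
    · exact hno (outcome_of_stable_nbrs hB hmin hBatt hBS v.2 (fun x hx => (hmem x (hct hx)).1)
        (fun x hx => (hmem x (hct hx)).2) hst hc hh)
  have hfib : ∀ v, ∀ t ⊆ S'.toFinset, (∀ s ∈ t, y s = v) → t.card < h := by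
    intro v t ht htv
    by_contra! hle
    obtain ⟨c, hct, hc⟩ := Finset.exists_subset_card_eq hle
    have : Nonempty V := ⟨v⟩
    obtain ⟨a, ha, hac⟩ := exists_enum c
    have hcS : ∀ i ∈ Finset.range c.card, a i ∈ S' := fun i hi =>
      Set.mem_toFinset.1 (ht (hct (hac i hi)))
    refine hno (outcome_of_path (m := 0) (p := fun _ => v) ⟨fun i hi j hj _ => by omega,
      fun i hi j hj => iff_of_false (G.loopless.irrefl _) (by omega)⟩ (fun _ _ => hBS v v.2)
      ((Finset.card_range _).trans hc) ha hcS (fun i hi => ⟨0, le_rfl, ?_⟩))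
    rw [← htv _ (hct (hac i hi))]
    exact hy _ (hcS i hi)
  obtain ⟨r, hr⟩ := hB.nonempty
  obtain ⟨m, p, hp0, hp, U, hU, hU'⟩ := exists_useful_path (r := (⟨r, hr⟩ : B)) hB y hdeg hfib
    (20 * h) (by rwa [← Set.ncard_eq_toFinset_card'])
  rw [← hp0] at hp hU'
  exact hno (outcome_of_useful_path hB hmin hBS (by omega) hy hp hU
    (fun i hi => by simpa only [Set.mem_toFinset] using hU' i hi))

/-- the connectifier theorem. -/
theorem stmt_12 (h' : ℕ) (hh : 1 ≤ h') :
    ∃ ν : ℕ, 1 ≤ ν ∧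
      ∀ (V : Type) [Fintype V] (G : SimpleGraph V) (S' : Set V),
        G.Connected → G.CliqueFree h' → ν ≤ S'.ncard →
        ConnSet G (Set.univ \ S') →
        (∀ s ∈ S', ∃ w : V, w ∉ S' ∧ G.Adj s w) →
        ∃ St : Set V, St ⊆ S' ∧ St.ncard = h' ∧
          ∃ W : Set V, W ⊆ Set.univ \ S' ∧
            ((IsPathGraph (G.induce W) ∧ ∀ s ∈ St, ∃ w ∈ W, G.Adj s w) ∨
             ((IsCaterpillar (G.induce W) ∨ IsLineGraphOfCaterpillar (G.induce W) ∨
                IsSubdividedStar (G.induce W)) ∧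
              (∀ s ∈ St, ∃! w : V, w ∈ W ∧ G.Adj s w) ∧
              (∀ w ∈ W, ((∃ s ∈ St, G.Adj s w) ↔ SimplicialIn G W w)))) := by
  obtain ⟨n, hn⟩ := exists_ramsey h' h'
  refine ⟨heavyBound n h' (20 * h') + 1, Nat.succ_pos _, ?_⟩
  intro V _ G S' _ hfree hcard hconn hatt
  obtain ⟨s, hs⟩ := Set.nonempty_of_ncard_ne_zero (s := S') (by omega)
  obtain ⟨w, -, hsw⟩ := hatt s hs
  have hh2 : 2 < h' := by
    by_contra! hle
    rw [cliqueFree_two.1 (hfree.mono hle)] at hsw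
    exact hsw
  exact outcome_of_heavy hh2 hn hfree (by omega) hconn hatt
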